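/- Suppose the (k,p,q)-differential condition holds and that every closed two-sided *-ideal of A of finite codimension (as a linear subspace) possesses a bounded left approximate identity. Let X be a weak Banach A-bimodule and θ : A → X an A-intertwining operator, where A is regarded as a Banach A-bimodule over itself via multiplication. Then θ is continuous if and only if the continuity ideal 𝓘(θ) := {a ∈ A : the maps b ↦ θ(a·b) and b ↦ θ(b·a) from A to X are continuous} is a closed subset of A. -/

import Mathlib

open Filter Topology

/-- A gliding hump argument: a linear map intertwining mutually orthogonal operators up to
continuous errors is continuous on the square of one of them. -/
theorem exists_continuous_comp_sq_of_orthogonal {E X : Type*}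
    [NormedAddCommGroup E] [NormedSpace ℂ E] [CompleteSpace E]
    [NormedAddCommGroup X] [NormedSpace ℂ X]
    (T : E →ₗ[ℂ] X) (S : ℕ → E →L[ℂ] E) (R : ℕ → X →L[ℂ] X)
    (hTS : ∀ n, Continuous fun b => T (S n b) - R n (T b))
    (hS : ∀ m n, m ≠ n → ∀ b, S m (S n b) = 0) :
    ∃ n, Continuous fun b => T (S n (S n b)) := by
  by_contra! hcon
  let Δ : ℕ → E →L[ℂ] X := fun n =>
    ⟨T ∘ₗ (S n).toLinearMap - (R n).toLinearMap ∘ₗ T, hTS n⟩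
  have hΔ : ∀ n b, T (S n b) = R n (T b) + Δ n b := by
    intro n b
    change _ = _ + (T (S n b) - R n (T b))
    abel
  have hchoice : ∀ n, ∃ b : E, ‖S n b‖ ≤ (1 / 2) ^ n ∧
      (n : ℝ) * (‖R n‖ + 1) + 2 * ‖Δ n‖ < ‖T (S n (S n b))‖ := by
    intro n
    by_contra! hb
    refine hcon n ?_
    set M : ℝ := (n : ℝ) * (‖R n‖ + 1) + 2 * ‖Δ n‖
    set r : ℝ := (1 / 2) ^ n / (‖S n‖ + 1)
    have hr : 0 < r := by positivity
    have hball : ∀ z ∈ Metric.ball (0 : E) r,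
        ‖(T ∘ₗ (S n).toLinearMap ∘ₗ (S n).toLinearMap) z‖ ≤ M := by
      intro z hz
      refine hb z ?_
      rw [mem_ball_zero_iff] at hz
      calc ‖S n z‖ ≤ ‖S n‖ * ‖z‖ := (S n).le_opNorm z
        _ ≤ (‖S n‖ + 1) * r := by gcongr; linarith
        _ = (1 / 2) ^ n := by simp only [r]; field_simp
    obtain ⟨C, hC⟩ := LinearMap.bound_of_ball_bound hr M _ hball
    exact AddMonoidHomClass.continuous_of_bound
      (T ∘ₗ (S n).toLinearMap ∘ₗ (S n).toLinearMap) C hC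
  choose b hb1 hb2 using hchoice
  have hsum : Summable fun n => S n (b n) :=
    Summable.of_norm_bounded (summable_geometric_of_lt_one (by norm_num) (by norm_num)) hb1
  set c := ∑' n, S n (b n) with hc
  have hcn : ‖c‖ ≤ 2 := by
    refine (tsum_of_norm_bounded ?_ hb1)
    exact hasSum_geometric_two
  have hSc : ∀ n, S n c = S n (S n (b n)) := by
    intro n
    rw [hc, (S n).map_tsum hsum]
    exact tsum_eq_single n fun m hm => hS n m hm.symm _
  obtain ⟨n, hn⟩ := exists_nat_gt ‖T c‖
  have h1 := hb2 n
  rw [← hSc, hΔ] at h1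
  have h2 : ‖R n (T c) + Δ n c‖ ≤ ‖R n‖ * ‖T c‖ + ‖Δ n‖ * 2 :=
    (norm_add_le _ _).trans (add_le_add ((R n).le_opNorm _)
      (((Δ n).le_opNorm _).trans (by gcongr)))
  nlinarith [norm_nonneg (R n), norm_nonneg (T c), mul_le_mul_of_nonneg_left hn.le (norm_nonneg (R n))]

/-- Cohen factorization with norm control. -/
theorem exists_bound_factorization {A J : Type*} [NormedRing A] [NormedAlgebra ℂ A]
    [CompleteSpace A] (I : Submodule ℂ A) (hI : IsClosed (I : Set A))
    (hIl : ∀ a x : A, x ∈ I → a * x ∈ I)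
    (F : Filter J) [F.NeBot] (e : J → A) (he : ∀ j, e j ∈ I) (M : ℝ) (hM : ∀ j, ‖e j‖ ≤ M)
    (hlim : ∀ x ∈ I, Tendsto (fun j => e j * x) F (𝓝 x)) :
    ∃ K : ℝ, ∀ b ∈ I, ∃ a ∈ I, ∃ y ∈ I, b = a * y ∧ ‖a‖ ≤ K ∧ ‖y‖ ≤ 3 * ‖b‖ := by
  have hM0 : 0 ≤ M := by
    obtain ⟨j⟩ := F.nonempty_of_neBot
    exact (norm_nonneg _).trans (hM j)
  -- the elements `(1 - c) + c e` are invertible with uniformly bounded inverses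
  set d : ℝ := 1 / (2 * (M + 1)) with hd
  have hd0 : 0 < d := by positivity
  set c : ℝ := d / (1 + d) with hcdef
  have hc0 : 0 < c := by positivity
  have hc1 : 1 - c = 1 / (1 + d) := by rw [hcdef]; field_simp; ring
  have hone_sub : 0 < 1 - c := by rw [hc1]; positivity
  have hcd : c = (1 - c) * d := by rw [hc1, hcdef]; ring
  have hdM : d * M ≤ 1 / 2 := by
    rw [hd, div_mul_eq_mul_div, div_le_div_iff₀ (by positivity) (by norm_num)]; linarith
  let E : J → A := fun j => (1 - c) • (1 : A) + c • e j
  obtain ⟨N, hN⟩ : ∃ N : ℝ, ∀ j, ∃ g : A, g * E j = 1 ∧ E j * g = 1 ∧ ‖g‖ ≤ N := by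
    refine ⟨(1 - c)⁻¹ * (‖(1 : A)‖ - 1 + (1 - 1 / 2)⁻¹), fun j => ?_⟩
    have hle : ‖-(d • e j)‖ ≤ 1 / 2 := by
      rw [norm_neg, norm_smul, Real.norm_of_nonneg hd0.le]
      exact (mul_le_mul_of_nonneg_left (hM j) hd0.le).trans hdM
    have hlt : ‖-(d • e j)‖ < 1 := by linarith
    have hE : E j = (1 - c) • (1 - -(d • e j)) := by
      simp only [E]; rw [sub_neg_eq_add, smul_add, smul_smul, ← hcd]
    refine ⟨(1 - c)⁻¹ • ∑' n : ℕ, (-(d • e j)) ^ n, ?_, ?_, ?_⟩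
    · rw [hE, smul_mul_smul_comm, inv_mul_cancel₀ hone_sub.ne', one_smul,
        geom_series_mul_neg _ hlt]
    · rw [hE, smul_mul_smul_comm, mul_inv_cancel₀ hone_sub.ne', one_smul,
        mul_neg_geom_series _ hlt]
    · rw [norm_smul, Real.norm_of_nonneg (inv_pos.2 hone_sub).le]
      gcongr
      refine (tsum_geometric_le_of_norm_lt_one _ hlt).trans ?_
      gcongr
  choose G hGE hEG hGN using hN
  have hGlim : ∀ x ∈ I, Tendsto (fun j => G j * x) F (𝓝 x) := by
    intro x hx
    have h0 : Tendsto (fun j => c * N * ‖x - e j * x‖) F (𝓝 0) := by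
      have := ((tendsto_const_nhds (x := x)).sub (hlim x hx)).norm.const_mul (c * N)
      simpa using this
    rw [tendsto_iff_norm_sub_tendsto_zero]
    refine squeeze_zero (fun _ => norm_nonneg _) (fun j => ?_) h0
    have : G j * x - x = c • (G j * (x - e j * x)) := by
      have h1 : x = G j * (E j * x) := by rw [← mul_assoc, hGE, one_mul]
      have h2 : E j * x = x - c • (x - e j * x) := by
        simp only [E, add_mul, sub_mul, smul_mul_assoc, one_mul, sub_smul, one_smul, smul_sub]; abel
      calc G j * x - x = G j * x - G j * (E j * x) := by rw [← h1]
        _ = _ := by rw [h2, mul_sub, mul_smul_comm]; abel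
    rw [this, norm_smul, Real.norm_of_nonneg hc0.le, mul_assoc]
    gcongr
    exact (norm_mul_le _ _).trans (by gcongr; exact hGN j)
  refine ⟨M, fun b hb => ?_⟩
  rcases eq_or_ne b 0 with rfl | hb0
  · exact ⟨0, I.zero_mem, 0, I.zero_mem, by simp, by simpa using hM0, by simp⟩
  have hbn : 0 < ‖b‖ := norm_pos_iff.2 hb0
  -- one step of the construction
  have hstep : ∀ (n : ℕ) (s : I) (u : Aˣ), (u : A) = ((1 - c) ^ n) • (1 : A) + (s : A) →
      ∃ (j : J) (v : Aˣ),
        (v : A) = ((1 - c) ^ (n + 1)) • (1 : A) + ((s : A) + (c * (1 - c) ^ n) • e j) ∧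
        ‖(↑v⁻¹ : A) * b - (↑u⁻¹ : A) * b‖ ≤ ‖b‖ * (1 / 2) ^ n := by
    intro n s u hu
    have hw : Tendsto (fun j => ((1 - c) ^ n) • (1 : A) + G j * s) F (𝓝 (u : A)) := by
      rw [hu]; exact (hGlim s s.2).const_add _
    have hunit : ∀ᶠ j in F, IsUnit (((1 - c) ^ n) • (1 : A) + G j * s) :=
      hw (Units.isOpen.mem_nhds u.isUnit)
    have hinv := ((NormedRing.inverse_continuousAt u).tendsto.comp hw).mul (hGlim b hb)
    rw [Ring.inverse_unit] at hinv
    have hclose := (tendsto_iff_norm_sub_tendsto_zero.1 hinv).eventually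
      (gt_mem_nhds (by positivity : 0 < ‖b‖ * (1 / 2) ^ n))
    obtain ⟨j, ⟨w, hwj⟩, hj⟩ := (hunit.and hclose).exists
    let Eu : Aˣ := ⟨E j, G j, hEG j, hGE j⟩
    refine ⟨j, Eu * w, ?_, ?_⟩
    · rw [Units.val_mul, hwj]
      change E j * _ = _
      rw [mul_add, ← mul_assoc, hEG, one_mul, mul_smul_comm, mul_one]
      simp only [E, smul_add, smul_smul, pow_succ]
      rw [mul_comm c]; abel
    · simp only [Function.comp_apply, ← hwj, Ring.inverse_unit] at hj
      rw [mul_inv_rev, Units.val_mul, mul_assoc]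
      exact hj.le
  choose nj nv hv1 hv2 using hstep
  let St : ℕ → Type _ := fun n => {q : I × Aˣ // (q.2 : A) = ((1 - c) ^ n) • (1 : A) + (q.1 : A)}
  let seq : (n : ℕ) → St n := fun n => Nat.rec (⟨(0, 1), by simp⟩ : St 0)
    (fun n q => ⟨(q.1.1 + (c * (1 - c) ^ n) • ⟨e (nj n q.1.1 q.1.2 q.2), he _⟩, nv n q.1.1 q.1.2 q.2),
      hv1 n q.1.1 q.1.2 q.2⟩) n
  let s : ℕ → I := fun n => (seq n).1.1
  let u : ℕ → Aˣ := fun n => (seq n).1.2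
  have hs : ∀ n, ∃ j, (s (n + 1) : A) = s n + (c * (1 - c) ^ n) • e j := fun n => ⟨_, rfl⟩
  have hu : ∀ n, (u n : A) = ((1 - c) ^ n) • (1 : A) + (s n : A) := fun n => (seq n).2
  have hdist : ∀ n, ‖(↑(u (n + 1))⁻¹ : A) * b - (↑(u n)⁻¹ : A) * b‖ ≤ ‖b‖ * (1 / 2) ^ n :=
    fun n => hv2 n _ _ (seq n).2
  have hs0 : (s 0 : A) = 0 := rfl
  have hu0 : u 0 = 1 := rfl
  have hsn : ∀ n, ‖(s n : A)‖ ≤ M * (1 - (1 - c) ^ n) := by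
    intro n
    induction n with
    | zero => simp [hs0]
    | succ n ih =>
      obtain ⟨j, hj⟩ := hs n
      rw [hj]
      refine (norm_add_le _ _).trans ?_
      rw [norm_smul, Real.norm_of_nonneg (by positivity)]
      have := mul_le_mul_of_nonneg_left (hM j) (by positivity : 0 ≤ c * (1 - c) ^ n)
      rw [pow_succ]; nlinarith
  have hsc : CauchySeq fun n => (s n : A) := by
    refine cauchySeq_of_le_geometric (1 - c) (c * M) (by linarith) fun n => ?_
    obtain ⟨j, hj⟩ := hs n
    rw [dist_comm, dist_eq_norm, hj, add_sub_cancel_left, norm_smul,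
      Real.norm_of_nonneg (by positivity)]
    have := mul_le_mul_of_nonneg_left (hM j) (by positivity : 0 ≤ c * (1 - c) ^ n)
    nlinarith
  have hyd : ∀ n, dist ((↑(u n)⁻¹ : A) * b) ((↑(u (n + 1))⁻¹ : A) * b) ≤ ‖b‖ * (1 / 2) ^ n := by
    intro n; rw [dist_comm, dist_eq_norm]; exact hdist n
  obtain ⟨a, ha⟩ := cauchySeq_tendsto_of_complete hsc
  obtain ⟨y, hy⟩ := cauchySeq_tendsto_of_complete
    (cauchySeq_of_le_geometric (1 / 2) ‖b‖ (by norm_num) hyd)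
  have hpow : Tendsto (fun n => (1 - c) ^ n) atTop (𝓝 0) :=
    tendsto_pow_atTop_nhds_zero_of_lt_one hone_sub.le (by linarith)
  have hua : Tendsto (fun n => (u n : A)) atTop (𝓝 a) := by
    have := (hpow.smul_const (1 : A)).add ha
    simpa [hu] using this
  refine ⟨a, hI.mem_of_tendsto ha (.of_forall fun n => (s n).2), y,
    hI.mem_of_tendsto hy (.of_forall fun n => hIl _ _ hb), ?_, ?_, ?_⟩
  · refine tendsto_nhds_unique (tendsto_const_nhds (x := b)) ((hua.mul hy).congr fun n => ?_)
    rw [← mul_assoc, Units.mul_inv, one_mul]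
  · refine le_of_tendsto ha.norm (.of_forall fun n => (hsn n).trans ?_)
    nlinarith [pow_nonneg hone_sub.le n]
  · have := dist_le_of_le_geometric_of_tendsto₀ (1 / 2) ‖b‖ (by norm_num) hyd hy
    rw [hu0, dist_comm, dist_eq_norm] at this
    have h2 : ‖y‖ ≤ ‖y - (↑(1 : Aˣ)⁻¹ : A) * b‖ + ‖(↑(1 : Aˣ)⁻¹ : A) * b‖ := by
      simpa using norm_add_le (y - (↑(1 : Aˣ)⁻¹ : A) * b) ((↑(1 : Aˣ)⁻¹ : A) * b)
    have h3 : (↑(1 : Aˣ)⁻¹ : A) * b = b := by simp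
    rw [h3] at this h2
    norm_num at this
    linarith

/-- A linear map bounded on a closed subspace of finite codimension is continuous. -/
theorem LinearMap.continuous_of_bound_on_finiteCodim {E X : Type*}
    [NormedAddCommGroup E] [NormedSpace ℂ E] [NormedAddCommGroup X] [NormedSpace ℂ X]
    (T : E →ₗ[ℂ] X) (I : Submodule ℂ E) (hI : IsClosed (I : Set E))
    [FiniteDimensional ℂ (E ⧸ I)] (K : ℝ) (hK : ∀ x ∈ I, ‖T x‖ ≤ K * ‖x‖) : Continuous T := by
  obtain ⟨P, hP⟩ := Submodule.ClosedComplemented.of_finiteDimensional_quotient hI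
  have hTI : Continuous (T ∘ₗ I.subtype) :=
    AddMonoidHomClass.continuous_of_bound (T ∘ₗ I.subtype) K fun x => hK x x.2
  let Q : E →ₗ[ℂ] X := T ∘ₗ (LinearMap.id - I.subtype ∘ₗ P.toLinearMap)
  have hQ : I ≤ Q.ker := by
    intro x hx
    simp only [Q, LinearMap.mem_ker, LinearMap.comp_apply, LinearMap.sub_apply]
    have := hP ⟨x, hx⟩
    simp [this]
  have : IsClosed (I : Set E) := hI
  have hQc : Continuous (I.liftQ Q hQ) := LinearMap.continuous_of_finiteDimensional _
  have hmk : Continuous (Submodule.Quotient.mk : E → E ⧸ I) := I.mkQL.continuous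
  have := (hTI.comp P.continuous).add (hQc.comp hmk)
  refine this.congr fun x => ?_
  simp [Q]

section FiniteDim

variable {D : Type*} [Ring D] [StarRing D] [Algebra ℂ D] [StarModule ℂ D]

/-- A projection `p` whose corner `p D p` consists of scalar multiples of `p`. -/
def IsScalarCorner (p : D) : Prop :=
  IsStarProjection p ∧ ∀ x : D, ∃ z : ℂ, p * x * p = z • p

/-- A non-scalar corner contains a proper nonzero subprojection. -/
theorem IsStarProjection.exists_proper_sub
    (halg : ∀ a : D, IsSelfAdjoint a → ∃ Λ : Finset ℝ,
      (Λ.toList.map fun l : ℝ => a - algebraMap ℂ D l).prod = 0)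
    {p : D} (hp : IsStarProjection p) (hns : ¬ IsScalarCorner p) :
    ∃ q : D, IsStarProjection q ∧ q ≠ 0 ∧ q ≠ p ∧ q * p = q ∧ p * q = q := by
  have hpp : p * p = p := hp.isIdempotentElem
  have hps : star p = p := hp.isSelfAdjoint
  obtain ⟨x, hxs, hpx, hxp, hx⟩ : ∃ x : D, IsSelfAdjoint x ∧ p * x = x ∧ x * p = x ∧
      ∀ z : ℂ, x ≠ z • p := by
    by_contra! hcon
    refine hns ⟨hp, fun x => ?_⟩
    have hre := hcon (p * (realPart x : D) * p) (by
      simp [IsSelfAdjoint, hps, mul_assoc, (realPart x).2.star_eq])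
      (by simp [← mul_assoc, hpp]) (by simp [mul_assoc, hpp])
    have him := hcon (p * (imaginaryPart x : D) * p) (by
      simp [IsSelfAdjoint, hps, mul_assoc, (imaginaryPart x).2.star_eq])
      (by simp [← mul_assoc, hpp]) (by simp [mul_assoc, hpp])
    obtain ⟨z, hz⟩ := hre
    obtain ⟨w, hw⟩ := him
    refine ⟨z + Complex.I * w, ?_⟩
    conv_lhs => rw [← realPart_add_I_smul_imaginaryPart x]
    rw [mul_add, add_mul, hz, mul_smul_comm, smul_mul_assoc, hw, smul_smul, add_smul]
  -- a shortest list of distinct real numbers annihilating the corner element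
  have hex : ∃ n : ℕ, ∃ l : List ℝ, l.Nodup ∧ l.length = n ∧
      (l.map fun t : ℝ => x - algebraMap ℂ D t).prod * p = 0 := by
    obtain ⟨Λ, hΛ⟩ := halg x hxs
    exact ⟨_, Λ.toList, Λ.nodup_toList, rfl, by rw [hΛ, zero_mul]⟩
  classical
  obtain ⟨l, hnd, hlen, hl0⟩ := Nat.find_spec hex
  have hmin : ∀ l' : List ℝ, l'.Nodup → l'.length < l.length →
      (l'.map fun t : ℝ => x - algebraMap ℂ D t).prod * p ≠ 0 := by
    intro l' h1 h2 h3
    exact Nat.find_min hex (hlen ▸ h2) ⟨l', h1, rfl, h3⟩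
  have hp0 : p ≠ 0 := by
    rintro rfl
    exact hx 0 (by rw [← hxp]; simp)
  match l, hnd, hl0, hmin with
  | [], _, hl0, _ => exact absurd (by simpa using hl0) hp0
  | t :: l, hnd, hl0, hmin =>
    rw [List.nodup_cons] at hnd
    set y := (l.map fun t : ℝ => x - algebraMap ℂ D t).prod * p with hy
    have hy0 : y ≠ 0 := hmin l hnd.2 (by simp)
    have hxy : x * y = (t : ℂ) • y := by
      rw [List.map_cons, List.prod_cons, mul_assoc, ← hy, sub_mul, sub_eq_zero] at hl0
      rw [hl0, Algebra.smul_def]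
    have hcomm : ∀ l : List ℝ, Commute (l.map fun t : ℝ => x - algebraMap ℂ D t).prod x ∧
        Commute (l.map fun t : ℝ => x - algebraMap ℂ D t).prod p ∧
        IsSelfAdjoint (l.map fun t : ℝ => x - algebraMap ℂ D t).prod := by
      intro l
      induction l with
      | nil => simp [IsSelfAdjoint]
      | cons a l ih =>
        have hcx : Commute (x - algebraMap ℂ D a) x :=
          (Commute.refl x).sub_left (Algebra.commutes _ _)
        have hcp : Commute (x - algebraMap ℂ D a) p :=
          Commute.sub_left (hxp.trans hpx.symm) (Algebra.commutes _ _)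
        have hsa : IsSelfAdjoint (x - algebraMap ℂ D a) :=
          hxs.sub (by simp [IsSelfAdjoint, ← algebraMap_star_comm])
        rw [List.map_cons, List.prod_cons]
        refine ⟨hcx.mul_left ih.1, hcp.mul_left ih.2.1, ?_⟩
        refine (IsSelfAdjoint.commute_iff hsa ih.2.2).1 ?_
        exact Commute.sub_left ih.1.symm (Algebra.commutes _ _)
    have hys : IsSelfAdjoint y :=
      (IsSelfAdjoint.commute_iff (hcomm l).2.2 hp.isSelfAdjoint).1 (hcomm l).2.1
    have hyp : y * p = y := by rw [hy, mul_assoc, hpp]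
    have hpy : p * y = y := by rw [hy, (hcomm l).2.1.eq, ← mul_assoc, hpp]
    obtain ⟨r, hr0, hr⟩ : ∃ r : ℝ, r ≠ 0 ∧ y * y = (r : ℂ) • y := by
      have : ∀ l' : List ℝ, t ∉ l' → ∃ r : ℝ, r ≠ 0 ∧
          (l'.map fun t : ℝ => x - algebraMap ℂ D t).prod * y = (r : ℂ) • y := by
        intro l' hl'
        induction l' with
        | nil => exact ⟨1, one_ne_zero, by simp⟩
        | cons a l' ih =>
          rw [List.mem_cons, not_or] at hl'
          obtain ⟨r, hr0, hr⟩ := ih hl'.2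
          refine ⟨r * (t - a), mul_ne_zero hr0 (sub_ne_zero.2 hl'.1), ?_⟩
          rw [List.map_cons, List.prod_cons, mul_assoc, hr, mul_smul_comm, sub_mul, hxy,
            ← Algebra.smul_def, ← sub_smul, smul_smul]
          push_cast; rfl
      obtain ⟨r, hr0, hr⟩ := this l hnd.1
      refine ⟨r, hr0, ?_⟩
      rw [← hr]
      conv_lhs => rw [hy, mul_assoc, hpy]
    have hrC : (r : ℂ) ≠ 0 := by exact_mod_cast hr0
    refine ⟨(r : ℂ)⁻¹ • y, ⟨?_, ?_⟩, smul_ne_zero (inv_ne_zero hrC) hy0, ?_, ?_, ?_⟩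
    · rw [IsIdempotentElem, smul_mul_smul_comm, hr, smul_smul]
      congr 1; field_simp
    · simp [IsSelfAdjoint, star_smul, hys.star_eq]
    · intro h
      refine hx t ?_
      rw [← hxp, ← h, mul_smul_comm, hxy, smul_comm]
    · rw [smul_mul_assoc, hyp]
    · rw [mul_smul_comm, hpy]

theorem IsStarProjection.mem_span_scalarCorner
    (halg : ∀ a : D, IsSelfAdjoint a → ∃ Λ : Finset ℝ,
      (Λ.toList.map fun l : ℝ => a - algebraMap ℂ D l).prod = 0)
    (horth : ∀ p : ℕ → D, (∀ n, IsStarProjection (p n)) → (∀ n, p n ≠ 0) →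
      (∀ m n, m ≠ n → p m * p n = 0) → False)
    {p : D} (hp : IsStarProjection p) : p ∈ Submodule.span ℂ {q : D | IsScalarCorner q} := by
  let r : {q : D // IsStarProjection q} → {q : D // IsStarProjection q} → Prop :=
    fun q q' => q ≠ q' ∧ (q : D) * q' = q
  have hrel : ∀ {q q' : D}, IsStarProjection q → IsStarProjection q' → q * q' = q →
      q' * q = q := by
    intro q q' h h' e
    have := congrArg star e
    rwa [star_mul, h.isSelfAdjoint.star_eq, h'.isSelfAdjoint.star_eq] at this
  have hwf : WellFounded r := by
    rw [wellFounded_iff_isEmpty_descending_chain]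
    refine ⟨fun ⟨f, hf⟩ => ?_⟩
    have hle : ∀ n k, (f (n + k) : D) * f n = f (n + k) := by
      intro n k
      induction k with
      | zero => exact (f n).2.isIdempotentElem
      | succ k ih =>
        have h1 := (hf (n + k)).2
        calc (f (n + (k + 1)) : D) * f n
            = (f (n + k + 1) : D) * f (n + k) * f n := by rw [h1]; rfl
          _ = f (n + (k + 1)) := by rw [mul_assoc, ih, h1]; rfl
    have hle' : ∀ {n m}, n ≤ m → (f m : D) * f n = f m := by
      intro n m h; obtain ⟨k, rfl⟩ := Nat.exists_eq_add_of_le h; exact hle n k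
    have hle'' : ∀ {n m}, n ≤ m → (f n : D) * f m = f m := fun h =>
      hrel (f _).2 (f _).2 (hle' h)
    refine horth (fun n => (f n : D) - f (n + 1)) (fun n => ⟨?_, ?_⟩) (fun n h => ?_) ?_
    · rw [IsIdempotentElem, sub_mul, mul_sub, mul_sub, hle' (Nat.le_succ n),
        hle'' (Nat.le_succ n), hle' le_rfl, hle' le_rfl]
      abel
    · exact (f n).2.isSelfAdjoint.sub (f (n + 1)).2.isSelfAdjoint
    · exact (hf n).1 (Subtype.ext (sub_eq_zero.1 h).symm)
    · intro m n hmn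
      rcases lt_or_gt_of_ne hmn with h | h
      · rw [sub_mul, mul_sub, mul_sub, hle'' h.le, hle'' (by lia : m ≤ n + 1),
          hle'' (by lia : m + 1 ≤ n), hle'' (by lia : m + 1 ≤ n + 1)]
        abel
      · rw [sub_mul, mul_sub, mul_sub, hle' h.le, hle' (by lia : n ≤ m + 1),
          hle' (by lia : n + 1 ≤ m), hle' (by lia : n + 1 ≤ m + 1)]
        abel
  suffices ∀ q : {q : D // IsStarProjection q},
      (q : D) ∈ Submodule.span ℂ {q : D | IsScalarCorner q} from this ⟨p, hp⟩
  intro q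
  induction q using hwf.induction with
  | _ q ih =>
    obtain ⟨q, hq⟩ := q
    by_cases hsc : IsScalarCorner q
    · exact Submodule.subset_span hsc
    obtain ⟨q', hq', hq0, hne, h1, h2⟩ := hq.exists_proper_sub halg hsc
    have hd : IsStarProjection (q - q') := ⟨by
      rw [IsIdempotentElem, sub_mul, mul_sub, mul_sub, h1, h2, hq.isIdempotentElem.eq,
        hq'.isIdempotentElem.eq]; abel, hq.isSelfAdjoint.sub hq'.isSelfAdjoint⟩
    have e1 := ih ⟨q', hq'⟩ ⟨fun h => hne (congrArg Subtype.val h), h1⟩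
    have e2 := ih ⟨q - q', hd⟩ ⟨fun h => hq0 (by
      have := congrArg Subtype.val h; simpa using this), by
        change (q - q') * q = q - q'
        rw [sub_mul, h1, hq.isIdempotentElem.eq]⟩
    have := Submodule.add_mem _ e1 e2
    simpa using this

theorem finiteDimensional_of_selfAdjoint_algebraic
    (hproper : ∀ x : D, star x * x = 0 → x = 0)
    (halg : ∀ a : D, IsSelfAdjoint a → ∃ Λ : Finset ℝ,
      (Λ.toList.map fun l : ℝ => a - algebraMap ℂ D l).prod = 0)
    (horth : ∀ p : ℕ → D, (∀ n, IsStarProjection (p n)) → (∀ n, p n ≠ 0) →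
      (∀ m n, m ≠ n → p m * p n = 0) → False) : FiniteDimensional ℂ D := by
  let f : D → D → D →ₗ[ℂ] D := fun p q => LinearMap.mulLeft ℂ p ∘ₗ LinearMap.mulRight ℂ q
  have hf : ∀ p q x, f p q x = p * (x * q) := fun _ _ _ => rfl
  have hcorner : ∀ p q : D, IsScalarCorner p → IsScalarCorner q →
      FiniteDimensional ℂ (f p q).range := by
    intro p q ⟨hp, hp'⟩ ⟨hq, hq'⟩
    have hpp : p * p = p := hp.isIdempotentElem
    have hqq : q * q = q := hq.isIdempotentElem
    by_cases h0 : ∀ x, f p q x = 0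
    · have : f p q = 0 := LinearMap.ext h0
      rw [this, LinearMap.range_zero]; infer_instance
    push Not at h0
    obtain ⟨x, hx⟩ := h0
    set v := f p q x with hv
    have hpv : p * v = v := by rw [hv, hf, ← mul_assoc, hpp]
    have hvq : v * q = v := by rw [hv, hf, mul_assoc, mul_assoc, hqq]
    have hvs : star v * p = star v := by
      have := congrArg star hpv; rwa [star_mul, hp.isSelfAdjoint.star_eq] at this
    have hqv : q * star v = star v := by
      have := congrArg star hvq; rwa [star_mul, hq.isSelfAdjoint.star_eq] at this
    obtain ⟨z, hz⟩ := hp' (v * star v)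
    rw [← mul_assoc, hpv, mul_assoc, hvs] at hz
    have hz0 : z ≠ 0 := by
      rintro rfl
      rw [zero_smul] at hz
      refine hx (star_injective ?_)
      rw [star_zero]
      exact hproper _ (by rwa [star_star])
    refine Submodule.finiteDimensional_of_le (S₂ := Submodule.span ℂ {v}) ?_
    rintro _ ⟨y, rfl⟩
    obtain ⟨w, hw⟩ := hq' (star v * f p q y)
    have hyq : f p q y * q = f p q y := by rw [hf, mul_assoc, mul_assoc, hqq]
    have hpy : p * f p q y = f p q y := by rw [hf, ← mul_assoc, hpp]
    rw [← mul_assoc, hqv, mul_assoc, hyq] at hw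
    have key : z • f p q y = w • v := by
      calc z • f p q y = (z • p) * f p q y := by rw [smul_mul_assoc, hpy]
        _ = v * (star v * f p q y) := by rw [← hz, mul_assoc]
        _ = w • v := by rw [hw, mul_smul_comm, hvq]
    rw [Submodule.mem_span_singleton]
    exact ⟨z⁻¹ * w, by rw [mul_smul, ← key, inv_smul_smul₀ hz0]⟩
  have hadd : ∀ g h : D →ₗ[ℂ] D, FiniteDimensional ℂ g.range → FiniteDimensional ℂ h.range →
      FiniteDimensional ℂ (g + h).range := by
    intro g h _ _
    refine Submodule.finiteDimensional_of_le (S₂ := g.range ⊔ h.range) ?_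
    rintro _ ⟨x, rfl⟩
    exact Submodule.add_mem_sup ⟨x, rfl⟩ ⟨x, rfl⟩
  have hsmul : ∀ (c : ℂ) (g : D →ₗ[ℂ] D), FiniteDimensional ℂ g.range →
      FiniteDimensional ℂ (c • g).range := by
    intro c g _
    refine Submodule.finiteDimensional_of_le (S₂ := g.range) ?_
    rintro _ ⟨x, rfl⟩
    exact g.range.smul_mem c ⟨x, rfl⟩
  have hzero : FiniteDimensional ℂ (0 : D →ₗ[ℂ] D).range := by
    rw [LinearMap.range_zero]; infer_instance
  have hspan : ∀ p ∈ Submodule.span ℂ {q : D | IsScalarCorner q},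
      ∀ q ∈ Submodule.span ℂ {q : D | IsScalarCorner q}, FiniteDimensional ℂ (f p q).range := by
    intro p hp q hq
    induction hp using Submodule.span_induction with
    | zero => rwa [show f 0 q = 0 by ext; simp [hf]]
    | add a b _ _ iha ihb =>
      rw [show f (a + b) q = f a q + f b q by ext; simp [hf, add_mul]]; exact hadd _ _ iha ihb
    | smul c a _ iha =>
      rw [show f (c • a) q = c • f a q by ext; simp [hf]]; exact hsmul _ _ iha
    | mem p hp =>
      induction hq using Submodule.span_induction with
      | zero => rwa [show f p 0 = 0 by ext; simp [hf]]
      | add a b _ _ iha ihb =>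
        rw [show f p (a + b) = f p a + f p b by ext; simp [hf, mul_add]]; exact hadd _ _ iha ihb
      | smul c a _ iha =>
        rw [show f p (c • a) = c • f p a by ext; simp [hf]]; exact hsmul _ _ iha
      | mem q hq => exact hcorner p q hp hq
  have h1 : (1 : D) ∈ Submodule.span ℂ {q : D | IsScalarCorner q} :=
    (IsStarProjection.one D).mem_span_scalarCorner halg horth
  have := hspan 1 h1 1 h1
  rw [show f 1 1 = LinearMap.id by ext; simp [hf], LinearMap.range_id] at this
  exact Module.finite_def.2 (Module.Finite.iff_fg.1 this)

end FiniteDim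

/-- The squares of `sinc (η n)` are the Fourier coefficients of a triangle function. -/
theorem hasSum_sinc_sq_mul_exp {η x : ℝ} (hη : 0 < η) (h1 : 2 * η ≤ x)
    (h2 : x ≤ 2 * Real.pi - 2 * η) :
    HasSum (fun n : ℤ => ((Real.sinc (η * n) ^ 2 : ℝ) : ℂ) * Complex.exp (Complex.I * n * x)) 0 := by
  have hπ := Real.pi_pos
  have key : ∀ y : ℝ, 0 ≤ y → y ≤ 2 * Real.pi →
      HasSum (fun n : ℤ => 1 / (n : ℂ) ^ 2 * Complex.exp (Complex.I * n * y))
        (((y ^ 2 / 2 - Real.pi * y + Real.pi ^ 2 / 3 : ℝ)) : ℂ) := by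
    intro y hy0 hy1
    have h := hasSum_one_div_pow_mul_fourier_mul_bernoulliFun (k := 2) le_rfl
      (x := y / (2 * Real.pi)) ⟨by positivity, by rw [div_le_one (by positivity)]; exact hy1⟩
    convert h using 1
    · funext n
      rw [fourier_coe_apply]
      congr 2
      have : (Real.pi : ℂ) ≠ 0 := by exact_mod_cast hπ.ne'
      push_cast
      field_simp
    · rw [bernoulliFun_two]
      have : (Real.pi : ℂ) ≠ 0 := by exact_mod_cast hπ.ne'
      push_cast
      rw [mul_pow, Complex.I_sq]
      simp only [Nat.factorial]
      push_cast
      field_simp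
      ring
  have hx0 := key x (by linarith) (by linarith)
  have hxp := key (x + 2 * η) (by linarith) (by linarith)
  have hxm := key (x - 2 * η) (by linarith) (by linarith)
  have hηc : (η : ℂ) ≠ 0 := by exact_mod_cast hη.ne'
  have hs := ((((hx0.mul_left (1/2 : ℂ)).sub (hxp.mul_left (1/4 : ℂ))).sub
    (hxm.mul_left (1/4 : ℂ))).mul_left (1 / (η : ℂ) ^ 2)).add
      (hasSum_pi_single (0 : ℤ) (1 : ℂ))
  convert hs using 1
  · rfl
  · funext n
    by_cases hn : n = 0
    · subst hn; simp
    · have hnr : (n : ℝ) ≠ 0 := by exact_mod_cast hn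
      have hnc : (n : ℂ) ≠ 0 := by exact_mod_cast hn
      rw [Real.sinc_of_ne_zero (mul_ne_zero hη.ne' hnr), Pi.single_eq_of_ne hn]
      have e1 : Complex.exp (Complex.I * n * ((x + 2 * η : ℝ) : ℂ)) =
          Complex.exp (Complex.I * n * x) * Complex.exp ((η * n : ℂ) * Complex.I) ^ 2 := by
        rw [← Complex.exp_nat_mul, ← Complex.exp_add]; congr 1; push_cast; ring
      have e2 : Complex.exp (Complex.I * n * ((x - 2 * η : ℝ) : ℂ)) =
          Complex.exp (Complex.I * n * x) * Complex.exp (-(η * n : ℂ) * Complex.I) ^ 2 := by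
        rw [← Complex.exp_nat_mul, ← Complex.exp_add]; congr 1; push_cast; ring
      rw [e1, e2, Complex.exp_mul_I, Complex.exp_mul_I, Complex.cos_neg, Complex.sin_neg]
      push_cast
      have hcs := Complex.cos_sq' ((η : ℂ) * n)
      field_simp
      ring_nf
      rw [Complex.I_sq]
      have : Complex.cos ((η : ℂ) * n) ^ 2 = 1 - Complex.sin ((η : ℂ) * n) ^ 2 := hcs
      rw [this]
      ring
  · push_cast
    field_simp
    ring

/-- Multiplying Fourier coefficients by `sinc (r n)` averages the function over `[x - r, x + r]`. -/
theorem tsum_mul_sinc_mul_exp_eq_zero {a : ℤ → ℝ} (ha : Summable fun n => |a n|) {u v r : ℝ}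
    (hr : 0 < r)
    (hz : ∀ x ∈ Set.Icc u v, ∑' n : ℤ, (a n : ℂ) * Complex.exp (Complex.I * n * x) = 0) :
    ∀ x ∈ Set.Icc (u + r) (v - r),
      ∑' n : ℤ, ((a n * Real.sinc (r * n) : ℝ) : ℂ) * Complex.exp (Complex.I * n * x) = 0 := by
  intro x hx
  let f : ℤ → C(ℝ, ℂ) := fun n => ⟨fun t => (a n : ℂ) * Complex.exp (Complex.I * n * t), by fun_prop⟩
  have hfn : ∀ n t, ‖f n t‖ = |a n| := by
    intro n t
    simp only [f, ContinuousMap.coe_mk, norm_mul, Complex.norm_real, Real.norm_eq_abs]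
    rw [show Complex.I * n * (t : ℂ) = ((n * t : ℝ) : ℂ) * Complex.I by push_cast; ring,
      Complex.norm_exp_ofReal_mul_I, mul_one]
  have hsum : Summable fun n : ℤ =>
      ‖(f n).restrict (⟨Set.uIcc (x - r) (x + r), isCompact_uIcc⟩ : TopologicalSpace.Compacts ℝ)‖ := by
    refine ha.of_nonneg_of_le (fun _ => norm_nonneg _) fun n => ?_
    rw [ContinuousMap.norm_le _ (abs_nonneg _)]
    intro t
    exact (hfn n t).le
  have h := intervalIntegral.tsum_intervalIntegral_eq_of_summable_norm hsum
  have h0 : ∫ t in (x - r)..(x + r), ∑' n, f n t = 0 := by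
    rw [intervalIntegral.integral_congr (g := fun _ => (0 : ℂ))]
    · simp
    · intro t ht
      rw [Set.uIcc_of_le (by linarith)] at ht
      exact hz t ⟨by linarith [ht.1, hx.1], by linarith [ht.2, hx.2]⟩
  rw [h0] at h
  have hterm : ∀ n : ℤ, ∫ t in (x - r)..(x + r), f n t =
      (2 * r : ℂ) * (((a n * Real.sinc (r * n) : ℝ) : ℂ) * Complex.exp (Complex.I * n * x)) := by
    intro n
    simp only [f, ContinuousMap.coe_mk, intervalIntegral.integral_const_mul]
    by_cases hn : n = 0
    · subst hn; simp; ring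
    · have hnr : (n : ℝ) ≠ 0 := by exact_mod_cast hn
      have hnc : (n : ℂ) ≠ 0 := by exact_mod_cast hn
      have hrc : (r : ℂ) ≠ 0 := by exact_mod_cast hr.ne'
      rw [integral_exp_mul_complex (mul_ne_zero Complex.I_ne_zero hnc),
        Real.sinc_of_ne_zero (mul_ne_zero hr.ne' hnr)]
      have e1 : Complex.exp (Complex.I * n * ((x + r : ℝ) : ℂ)) =
          Complex.exp (Complex.I * n * x) * Complex.exp ((r * n : ℂ) * Complex.I) := by
        rw [← Complex.exp_add]; congr 1; push_cast; ring
      have e2 : Complex.exp (Complex.I * n * ((x - r : ℝ) : ℂ)) =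
          Complex.exp (Complex.I * n * x) * Complex.exp (-(r * n : ℂ) * Complex.I) := by
        rw [← Complex.exp_add]; congr 1; push_cast; ring
      rw [e1, e2, Complex.exp_mul_I, Complex.exp_mul_I, Complex.cos_neg, Complex.sin_neg]
      push_cast
      field_simp
      ring
  simp only [hterm] at h
  rw [tsum_mul_left] at h
  have hrc : (2 * r : ℂ) ≠ 0 := mul_ne_zero two_ne_zero (by exact_mod_cast hr.ne')
  exact (mul_eq_zero.mp h).resolve_left hrc

/-- Partial products of squared `sinc` multipliers. -/
noncomputable def sincProd (η : ℝ) (r : ℕ → ℝ) (N : ℕ) (n : ℤ) : ℝ :=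
  Real.sinc (η * n) ^ 2 * ∏ k ∈ Finset.range N, Real.sinc (r k * n) ^ 2

theorem sincProd_nonneg (η : ℝ) (r : ℕ → ℝ) (N : ℕ) (n : ℤ) : 0 ≤ sincProd η r N n :=
  mul_nonneg (sq_nonneg _) (Finset.prod_nonneg fun _ _ => sq_nonneg _)

theorem sincProd_succ (η : ℝ) (r : ℕ → ℝ) (N : ℕ) (n : ℤ) :
    sincProd η r (N + 1) n = sincProd η r N n * Real.sinc (r N * n) * Real.sinc (r N * n) := by
  simp only [sincProd, Finset.prod_range_succ]
  ring

theorem sincProd_antitone (η : ℝ) (r : ℕ → ℝ) (n : ℤ) : Antitone fun N => sincProd η r N n := by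
  refine antitone_nat_of_succ_le fun N => ?_
  rw [sincProd_succ, mul_assoc]
  refine mul_le_of_le_one_right (sincProd_nonneg _ _ _ _) ?_
  rw [← sq, sq_le_one_iff_abs_le_one]
  exact Real.abs_sinc_le_one _

theorem sinc_sq_le {t : ℝ} (ht : t ≠ 0) : Real.sinc t ^ 2 ≤ (|t|⁻¹) ^ 2 := by
  rw [Real.sinc_of_ne_zero ht, div_pow, inv_pow, sq_abs, div_eq_mul_inv]
  exact mul_le_of_le_one_left (by positivity) (Real.sin_sq_le_one t)

theorem sincProd_le_inv_sq {η : ℝ} (hη : 0 < η) (r : ℕ → ℝ) (N : ℕ) (n : ℤ) (hn : n ≠ 0) :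
    sincProd η r N n ≤ (η⁻¹) ^ 2 * (1 / (n : ℝ) ^ 2) := by
  have hnr : (n : ℝ) ≠ 0 := by exact_mod_cast hn
  refine (sincProd_antitone η r n (Nat.zero_le N)).trans ?_
  simp only [sincProd, Finset.range_zero, Finset.prod_empty, mul_one]
  refine (sinc_sq_le (mul_ne_zero hη.ne' hnr)).trans_eq ?_
  rw [inv_pow, sq_abs, mul_pow, mul_inv, inv_pow, one_div]

theorem summable_inv_sq_add_single (a : ℝ) :
    Summable fun n : ℤ => a * (1 / (n : ℝ) ^ 2) + (Pi.single 0 1 : ℤ → ℝ) n :=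
  ((Real.summable_one_div_int_pow.mpr one_lt_two).mul_left _).add
    (hasSum_pi_single (0 : ℤ) (1 : ℝ)).summable

theorem sincProd_le {η : ℝ} (hη : 0 < η) (r : ℕ → ℝ) (N : ℕ) (n : ℤ) :
    sincProd η r N n ≤ (η⁻¹) ^ 2 * (1 / (n : ℝ) ^ 2) + (Pi.single 0 1 : ℤ → ℝ) n := by
  by_cases hn : n = 0
  · subst hn
    simp [sincProd]
  · rw [Pi.single_eq_of_ne hn, add_zero]
    exact sincProd_le_inv_sq hη r N n hn

theorem summable_sincProd {η : ℝ} (hη : 0 < η) (r : ℕ → ℝ) (N : ℕ) :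
    Summable (sincProd η r N) :=
  (summable_inv_sq_add_single ((η⁻¹) ^ 2)).of_nonneg_of_le (sincProd_nonneg η r N)
    (sincProd_le hη r N)

theorem tsum_sincProd_mul_exp_eq_zero {η : ℝ} (hη : 0 < η) {r : ℕ → ℝ} (hr : ∀ k, 0 < r k)
    (N : ℕ) : ∀ x ∈ Set.Icc (2 * η + 2 * ∑ k ∈ Finset.range N, r k)
      (2 * Real.pi - 2 * η - 2 * ∑ k ∈ Finset.range N, r k),
      ∑' n : ℤ, (sincProd η r N n : ℂ) * Complex.exp (Complex.I * n * x) = 0 := by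
  induction N with
  | zero =>
    intro x hx
    simp only [Finset.range_zero, Finset.sum_empty, mul_zero, add_zero, sub_zero] at hx
    simpa [sincProd] using (hasSum_sinc_sq_mul_exp hη hx.1 hx.2).tsum_eq
  | succ N ih =>
    intro x hx
    rw [Finset.sum_range_succ] at hx
    have hs : Summable fun n => |sincProd η r N n| := (summable_sincProd hη r N).abs
    have h1 := tsum_mul_sinc_mul_exp_eq_zero hs (hr N) ih
    have hs' : Summable fun n : ℤ => |sincProd η r N n * Real.sinc (r N * n)| := by
      refine hs.of_nonneg_of_le (fun _ => abs_nonneg _) fun n => ?_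
      rw [abs_mul]
      exact mul_le_of_le_one_right (abs_nonneg _) (Real.abs_sinc_le_one _)
    have h2 := tsum_mul_sinc_mul_exp_eq_zero hs' (hr N) h1
    simp only [sincProd_succ]
    exact h2 x ⟨by linarith [hx.1], by linarith [hx.2]⟩

theorem tsum_iInf_sincProd_mul_exp_eq_zero {η σ : ℝ} (hη : 0 < η) {r : ℕ → ℝ} (hr : ∀ k, 0 < r k)
    (hσ : ∀ N, ∑ k ∈ Finset.range N, r k ≤ σ) {x : ℝ}
    (hx : x ∈ Set.Icc (2 * η + 2 * σ) (2 * Real.pi - 2 * η - 2 * σ)) :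
    ∑' n : ℤ, ((⨅ N, sincProd η r N n : ℝ) : ℂ) * Complex.exp (Complex.I * n * x) = 0 := by
  have hlim : Tendsto (fun N => ∑' n : ℤ, (sincProd η r N n : ℂ) * Complex.exp (Complex.I * n * x))
      atTop (𝓝 (∑' n : ℤ, ((⨅ N, sincProd η r N n : ℝ) : ℂ) * Complex.exp (Complex.I * n * x))) := by
    refine tendsto_tsum_of_dominated_convergence (summable_inv_sq_add_single ((η⁻¹) ^ 2)) ?_ ?_
    · intro n
      refine Tendsto.mul_const _ ?_
      refine (Complex.continuous_ofReal.tendsto _).comp ?_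
      exact tendsto_atTop_ciInf (sincProd_antitone η r n)
        ⟨0, by rintro _ ⟨N, rfl⟩; exact sincProd_nonneg η r N n⟩
    · refine Eventually.of_forall fun N n => ?_
      rw [norm_mul, show Complex.I * n * (x : ℂ) = ((n * x : ℝ) : ℂ) * Complex.I by push_cast; ring,
        Complex.norm_exp_ofReal_mul_I, mul_one, Complex.norm_real, Real.norm_eq_abs,
        abs_of_nonneg (sincProd_nonneg η r N n)]
      exact sincProd_le hη r N n
  refine tendsto_nhds_unique hlim ?_
  refine tendsto_const_nhds.congr fun N => ?_
  symm
  exact tsum_sincProd_mul_exp_eq_zero hη hr N x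
    ⟨by linarith [hx.1, hσ N], by linarith [hx.2, hσ N]⟩

theorem sincProd_le_exp_mul {η ρ s : ℝ} (hη : 0 < η) (hρ : 0 < ρ) (hs : 0 < s) (n : ℤ)
    (hn : n ≠ 0) :
    (⨅ N, sincProd η (fun k => ρ / ((k : ℝ) + 1) ^ s) N n) ≤
      (η⁻¹) ^ 2 * (1 / (n : ℝ) ^ 2) *
        (Real.exp 2 * Real.exp (-2 * (ρ * |(n : ℝ)| / Real.exp 1) ^ (1 / s))) := by
  have hnr : (n : ℝ) ≠ 0 := by exact_mod_cast hn
  have hna : 0 < |(n : ℝ)| := abs_pos.mpr hnr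
  set y : ℝ := (ρ * |(n : ℝ)| / Real.exp 1) ^ (1 / s) with hy
  have hy0 : 0 ≤ y := by positivity
  set N := ⌊y⌋₊
  have hNy : (N : ℝ) ≤ y := Nat.floor_le hy0
  have hyN : y < N + 1 := Nat.lt_floor_add_one y
  refine (ciInf_le ⟨0, by rintro _ ⟨N, rfl⟩; exact sincProd_nonneg _ _ N n⟩ N).trans ?_
  refine mul_le_mul ?_ ?_ (Finset.prod_nonneg fun _ _ => sq_nonneg _) (by positivity)
  · simpa [sincProd] using sincProd_le_inv_sq hη (fun _ => 0) 0 n hn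
  · have hfac : ∀ k ∈ Finset.range N,
        Real.sinc (ρ / ((k : ℝ) + 1) ^ s * n) ^ 2 ≤ Real.exp (-2) := by
      intro k hk
      have hkN : (k : ℝ) + 1 ≤ N := by exact_mod_cast Finset.mem_range.mp hk
      have hk0 : (0 : ℝ) < (k : ℝ) + 1 := by positivity
      refine (sinc_sq_le (mul_ne_zero (by positivity) hnr)).trans ?_
      have h1 : ((k : ℝ) + 1) ^ s ≤ ρ * |(n : ℝ)| / Real.exp 1 := by
        calc ((k : ℝ) + 1) ^ s ≤ y ^ s := Real.rpow_le_rpow hk0.le (hkN.trans hNy) hs.le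
          _ = _ := by
            rw [hy, ← Real.rpow_mul (by positivity), one_div_mul_cancel hs.ne', Real.rpow_one]
      have h2 : (|ρ / ((k : ℝ) + 1) ^ s * n|)⁻¹ ≤ Real.exp (-1) := by
        rw [abs_mul, abs_of_pos (by positivity : 0 < ρ / ((k : ℝ) + 1) ^ s), Real.exp_neg]
        refine inv_anti₀ (Real.exp_pos _) ?_
        rw [le_div_iff₀ (Real.exp_pos _)] at h1
        rw [div_mul_eq_mul_div, le_div_iff₀ (by positivity)]
        linarith
      calc _ ≤ Real.exp (-1) ^ 2 := pow_le_pow_left₀ (by positivity) h2 2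
        _ = Real.exp (-2) := by rw [← Real.exp_nat_mul]; norm_num
    calc _ ≤ ∏ _k ∈ Finset.range N, Real.exp (-2) :=
          Finset.prod_le_prod (fun _ _ => sq_nonneg _) hfac
      _ = Real.exp (-2 * N) := by
        rw [Finset.prod_const, Finset.card_range, ← Real.exp_nat_mul]; ring_nf
      _ ≤ _ := by
        rw [← Real.exp_add]
        exact Real.exp_le_exp.mpr (by linarith)

theorem exists_bound_exp_rpow_sub {γ β K κ : ℝ} (hγ : 0 < γ) (hβ : γ < β) (hκ : 0 < κ) :
    ∃ M : ℝ, ∀ x : ℝ, 0 ≤ x → K * x ^ γ - κ * x ^ β ≤ M := by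
  set X := (|K| / κ) ^ (1 / (β - γ)) with hX
  have hβγ : 0 < β - γ := by linarith
  have hX0 : 0 ≤ X := by positivity
  refine ⟨|K| * X ^ γ, fun x hx => ?_⟩
  have hK : K * x ^ γ ≤ |K| * x ^ γ := mul_le_mul_of_nonneg_right (le_abs_self K) (by positivity)
  rcases le_total x X with h | h
  · have h1 : |K| * x ^ γ ≤ |K| * X ^ γ :=
      mul_le_mul_of_nonneg_left (Real.rpow_le_rpow hx h hγ.le) (abs_nonneg K)
    have h2 : 0 ≤ κ * x ^ β := by positivity
    linarith
  · have h1 : |K| / κ ≤ x ^ (β - γ) := by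
      calc |K| / κ = X ^ (β - γ) := by
            rw [hX, ← Real.rpow_mul (by positivity), one_div_mul_cancel hβγ.ne', Real.rpow_one]
        _ ≤ _ := Real.rpow_le_rpow hX0 h hβγ.le
    rw [div_le_iff₀ hκ] at h1
    have h2 : x ^ β = x ^ (β - γ) * x ^ γ := by
      rcases hx.eq_or_lt with rfl | hx
      · rw [Real.zero_rpow (by linarith), Real.zero_rpow hγ.ne', mul_zero]
      · rw [← Real.rpow_add hx]; congr 1; ring
    have h3 : |K| * x ^ γ ≤ (x ^ (β - γ) * κ) * x ^ γ :=
      mul_le_mul_of_nonneg_right h1 (by positivity)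
    have h4 : 0 ≤ |K| * X ^ γ := by positivity
    rw [h2]
    nlinarith

/-- Non-quasianalyticity of the weights `exp (K |n| ^ γ)`, `γ < 1`: there are positive definite
bump functions on the circle with small support and Fourier coefficients decaying faster
than every such weight. -/
theorem exists_bump_coefficients {γ δ : ℝ} (hγ0 : 0 < γ) (hγ : γ < 1) (hδ : 0 < δ)
    (hδπ : δ ≤ Real.pi) :
    ∃ c : ℤ → ℝ, (∀ n, 0 ≤ c n) ∧ 0 < c 0 ∧
      (∀ K : ℝ, Summable fun n : ℤ => c n * Real.exp (K * |(n : ℝ)| ^ γ)) ∧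
      ∀ x : ℝ, Real.cos x ≤ Real.cos δ →
        ∑' n : ℤ, (c n : ℂ) * Complex.exp (Complex.I * n * x) = 0 := by
  set s : ℝ := 2 / (1 + γ) with hs
  have hs1 : 1 < s := by rw [hs, lt_div_iff₀ (by linarith)]; linarith
  have hs0 : 0 < s := by linarith
  have hsum : Summable fun k : ℕ => 1 / ((k : ℝ) + 1) ^ s := by
    have := (summable_nat_add_iff 1).mpr (Real.summable_one_div_nat_rpow.mpr hs1)
    simpa using this
  set Z : ℝ := ∑' k : ℕ, 1 / ((k : ℝ) + 1) ^ s with hZ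
  have hZ0 : 0 ≤ Z := tsum_nonneg fun k => by positivity
  set ρ : ℝ := δ / (4 * (Z + 1)) with hρdef
  have hρ : 0 < ρ := by positivity
  set η : ℝ := δ / 4 with hηdef
  have hη : 0 < η := by positivity
  set r : ℕ → ℝ := fun k => ρ / ((k : ℝ) + 1) ^ s with hrdef
  have hr : ∀ k, 0 < r k := fun k => by positivity
  have hσ : ∀ N, ∑ k ∈ Finset.range N, r k ≤ δ / 4 := by
    intro N
    have h1 : ∑ k ∈ Finset.range N, r k = ρ * ∑ k ∈ Finset.range N, 1 / ((k : ℝ) + 1) ^ s := by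
      rw [Finset.mul_sum]
      exact Finset.sum_congr rfl fun k _ => by simp only [hrdef]; ring
    have h2 : ∑ k ∈ Finset.range N, 1 / ((k : ℝ) + 1) ^ s ≤ Z + 1 :=
      (hsum.sum_le_tsum _ fun k _ => by positivity).trans (by linarith)
    calc _ ≤ ρ * (Z + 1) := by rw [h1]; exact mul_le_mul_of_nonneg_left h2 hρ.le
      _ = δ / 4 := by rw [hρdef]; field_simp
  refine ⟨fun n => ⨅ N, sincProd η r N n, fun n => Real.iInf_nonneg fun N => sincProd_nonneg η r N n,
    ?_, ?_, ?_⟩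
  · simp [sincProd]
  · intro K
    set κ : ℝ := 2 * (ρ / Real.exp 1) ^ (1 / s) with hκdef
    have hκ : 0 < κ := by positivity
    have hβ : γ < 1 / s := by rw [hs, one_div_div]; linarith
    obtain ⟨M, hM⟩ := exists_bound_exp_rpow_sub (K := K) hγ0 hβ hκ
    have hmaj : Summable fun n : ℤ =>
        ((η⁻¹) ^ 2 * (1 / (n : ℝ) ^ 2)) * (Real.exp 2 * Real.exp M) + (Pi.single 0 1 : ℤ → ℝ) n :=
      (((Real.summable_one_div_int_pow.mpr one_lt_two).mul_left _).mul_right _).add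
        (hasSum_pi_single (0 : ℤ) (1 : ℝ)).summable
    refine hmaj.of_nonneg_of_le (fun n => mul_nonneg (Real.iInf_nonneg fun N => sincProd_nonneg η r N n)
      (Real.exp_pos _).le) fun n => ?_
    by_cases hn : n = 0
    · subst hn
      simp [sincProd, Real.zero_rpow hγ0.ne']
    · rw [Pi.single_eq_of_ne hn, add_zero]
      refine (mul_le_mul_of_nonneg_right (sincProd_le_exp_mul hη hρ hs0 n hn)
        (Real.exp_pos _).le).trans ?_
      rw [mul_assoc]
      refine mul_le_mul_of_nonneg_left ?_ (by positivity)
      rw [mul_assoc]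
      refine mul_le_mul_of_nonneg_left ?_ (by positivity)
      rw [← Real.exp_add]
      refine Real.exp_le_exp.mpr ?_
      have h1 : (ρ * |(n : ℝ)| / Real.exp 1) ^ (1 / s) =
          (ρ / Real.exp 1) ^ (1 / s) * |(n : ℝ)| ^ (1 / s) := by
        rw [← Real.mul_rpow (by positivity) (abs_nonneg _)]; congr 1; ring
      have h2 := hM |(n : ℝ)| (abs_nonneg _)
      rw [h1]
      rw [hκdef] at h2
      linarith
  · intro x hx
    obtain ⟨m, hm⟩ : ∃ m : ℤ, x - m * (2 * Real.pi) ∈ Set.Ico 0 (2 * Real.pi) := by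
      refine ⟨⌊x / (2 * Real.pi)⌋, ?_⟩
      have hp : 0 < 2 * Real.pi := by positivity
      have h1 := Int.floor_le (x / (2 * Real.pi))
      have h2 := Int.lt_floor_add_one (x / (2 * Real.pi))
      rw [le_div_iff₀ hp] at h1
      rw [div_lt_iff₀ hp] at h2
      exact ⟨by linarith, by linarith⟩
    set y := x - m * (2 * Real.pi) with hy
    have hcos : Real.cos y ≤ Real.cos δ := by rw [hy, Real.cos_sub_int_mul_two_pi]; exact hx
    have hy1 : δ ≤ y := by
      by_contra! h
      exact absurd hcos (not_le.mpr (Real.cos_lt_cos_of_nonneg_of_le_pi hm.1 hδπ h))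
    have hy2 : y ≤ 2 * Real.pi - δ := by
      by_contra! h
      have : Real.cos δ < Real.cos (2 * Real.pi - y) :=
        Real.cos_lt_cos_of_nonneg_of_le_pi (by linarith [hm.2]) hδπ (by linarith)
      rw [Real.cos_two_pi_sub] at this
      linarith
    have h0 := tsum_iInf_sincProd_mul_exp_eq_zero hη hr hσ (x := y)
      ⟨by rw [hηdef]; linarith, by rw [hηdef]; linarith⟩
    rw [← h0]
    refine tsum_congr fun n => ?_
    congr 1
    have : Complex.I * n * (x : ℂ) =
        Complex.I * n * (y : ℂ) + ((n * m : ℤ) : ℂ) * (2 * Real.pi * Complex.I) := by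
      rw [hy]; push_cast; ring
    rw [this, Complex.exp_add, Complex.exp_int_mul_two_pi_mul_I, mul_one]

theorem norm_normedSpace_exp_le {A : Type*} [NormedRing A] [NormedAlgebra ℂ A] [CompleteSpace A]
    (x : A) : ‖NormedSpace.exp x‖ ≤ (1 + ‖(1 : A)‖) * Real.exp ‖x‖ := by
  have h := NormedSpace.exp_series_hasSum_exp' (𝕂 := ℂ) x
  have hr : HasSum (fun n : ℕ => (1 + ‖(1 : A)‖) * (‖x‖ ^ n / (n.factorial : ℝ)))
      ((1 + ‖(1 : A)‖) * Real.exp ‖x‖) := by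
    refine HasSum.mul_left _ ?_
    have := NormedSpace.exp_series_hasSum_exp' (𝕂 := ℝ) ‖x‖
    rw [← Real.exp_eq_exp_ℝ] at this
    simpa [div_eq_inv_mul] using this
  rw [← h.tsum_eq]
  refine tsum_of_norm_bounded hr fun n => ?_
  rw [norm_smul, norm_inv, Complex.norm_natCast, div_eq_inv_mul]
  have hx : ‖x ^ n‖ ≤ (1 + ‖(1 : A)‖) * ‖x‖ ^ n := by
    rcases Nat.eq_zero_or_pos n with rfl | hn
    · simp
    · refine (norm_pow_le' x hn).trans ?_
      have : 0 ≤ ‖(1 : A)‖ * ‖x‖ ^ n := by positivity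
      linarith
  calc _ ≤ (n.factorial : ℝ)⁻¹ * ((1 + ‖(1 : A)‖) * ‖x‖ ^ n) :=
        mul_le_mul_of_nonneg_left hx (by positivity)
    _ = _ := by ring

theorem exp_smul_mul_exp_smul {A : Type*} [NormedRing A] [NormedAlgebra ℂ A] [CompleteSpace A]
    (a : A) (z w : ℂ) :
    NormedSpace.exp (z • a) * NormedSpace.exp (w • a) = NormedSpace.exp ((z + w) • a) := by
  let _ : NormedAlgebra ℚ A := NormedAlgebra.restrictScalars ℚ ℂ A
  rw [add_smul, NormedSpace.exp_add_of_commute]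
  exact ((Commute.refl a).smul_left z).smul_right w

section DifferentialSubalgebra

variable {A B : Type*}
  [NormedRing A] [StarRing A] [NormedAlgebra ℂ A] [CompleteSpace A]
  [StarModule ℂ A] [ContinuousStar A]
  [NonUnitalNormedRing B] [StarRing B] [CStarRing B] [NormedSpace ℂ B]

theorem norm_map_exp_le_one (ι : A →⋆ₙₐ[ℂ] B) {a : A} (ha : IsSelfAdjoint a) (t : ℝ) :
    ‖ι (NormedSpace.exp ((Complex.I * t) • a))‖ ≤ 1 := by
  set u := NormedSpace.exp ((Complex.I * t) • a) with hu
  have hstar : star u = NormedSpace.exp ((-(Complex.I * t)) • a) := by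
    rw [hu, NormedSpace.star_exp, star_smul, ha.star_eq]
    congr 2
    simp
  have huu : star u * u = 1 := by
    rw [hstar, hu, exp_smul_mul_exp_smul]
    simp
  have h1 : ‖ι (1 : A)‖ ≤ 1 := by
    refine IsStarProjection.norm_le _ ⟨?_, ?_⟩
    · rw [IsIdempotentElem, ← map_mul, mul_one]
    · rw [IsSelfAdjoint, ← map_star, star_one]
  have h2 : ‖ι u‖ * ‖ι u‖ ≤ 1 := by
    rw [← CStarRing.norm_star_mul_self, ← map_star, ← map_mul, huu]
    exact h1
  nlinarith [norm_nonneg (ι u)]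

/-- In a differential subalgebra the groups `t ↦ exp (i t a)` with `a` self-adjoint have growth
at most `exp (D |t| ^ γ)` for some exponent `γ < 1`, locally uniformly in `a`. -/
theorem exists_exp_growth_bound (ι : A →⋆ₙₐ[ℂ] B)
    {k : ℕ} (hk : 2 ≤ k) {p q : ℝ} (hp : 0 < p) (hq : 0 < q) (hpq : p + q = (k : ℝ))
    {C : ℝ} (hdiff : ∀ a : A, ‖a ^ k‖ ≤ C * ‖a‖ ^ p * ‖ι a‖ ^ q) :
    ∃ γ : ℝ, 0 < γ ∧ γ < 1 ∧ ∀ M : ℝ, ∃ D : ℝ, 0 ≤ D ∧ ∀ a : A, IsSelfAdjoint a → ‖a‖ ≤ M →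
      ∀ t : ℝ, ‖NormedSpace.exp ((Complex.I * t) • a)‖ ≤ Real.exp (D * (1 + |t| ^ γ)) := by
  have hk1 : (1 : ℝ) < k := by exact_mod_cast hk
  have hk0 : (0 : ℝ) < k := by linarith
  have hpk : p < k := by linarith
  set ρ : ℝ := (max p 1 + k) / 2 with hρ
  have hm1 : p ≤ max p 1 := le_max_left _ _
  have hm2 : 1 ≤ max p 1 := le_max_right _ _
  have hm3 : max p 1 < k := max_lt hpk hk1
  have hρ1 : 1 < ρ := by rw [hρ]; linarith
  have hρp : p < ρ := by rw [hρ]; linarith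
  have hρk : ρ < k := by rw [hρ]; linarith
  have hρ0 : 0 < ρ := by linarith
  refine ⟨Real.logb k ρ, Real.logb_pos hk1 hρ1, ?_, fun M => ?_⟩
  · rw [Real.logb_lt_iff_lt_rpow hk1 hρ0, Real.rpow_one]; exact hρk
  set C' := max C 1 with hC'
  have hC'1 : 1 ≤ C' := le_max_right _ _
  have hlogC : 0 ≤ Real.log C' := Real.log_nonneg hC'1
  set L := max (Real.log ((1 + ‖(1 : A)‖) * Real.exp M)) 0 with hL
  set D := max L (Real.log C' / (ρ - p)) with hD
  have hL0 : 0 ≤ L := le_max_right _ _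
  have hD0 : 0 ≤ D := hL0.trans (le_max_left _ _)
  have hDC : Real.log C' ≤ D * (ρ - p) := by
    rw [← div_le_iff₀ (by linarith)]; exact le_max_right _ _
  refine ⟨D * ρ, by positivity, fun a ha haM t => ?_⟩
  have hstep : ∀ t : ℝ, ‖NormedSpace.exp ((Complex.I * ((k * t : ℝ) : ℂ)) • a)‖ ≤
      C' * ‖NormedSpace.exp ((Complex.I * t) • a)‖ ^ p := by
    intro t
    let _ : NormedAlgebra ℚ A := NormedAlgebra.restrictScalars ℚ ℂ A
    have h1 : NormedSpace.exp ((Complex.I * ((k * t : ℝ) : ℂ)) • a) =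
        NormedSpace.exp ((Complex.I * t) • a) ^ k := by
      rw [← NormedSpace.exp_nsmul, ← Nat.cast_smul_eq_nsmul ℂ, smul_smul]
      congr 2
      push_cast; ring
    rw [h1]
    refine (hdiff _).trans ?_
    have h2 : ‖ι (NormedSpace.exp ((Complex.I * t) • a))‖ ^ q ≤ 1 :=
      Real.rpow_le_one (norm_nonneg _) (norm_map_exp_le_one ι ha t) hq.le
    have h3 : 0 ≤ ‖NormedSpace.exp ((Complex.I * t) • a)‖ ^ p := by positivity
    calc _ ≤ C' * ‖NormedSpace.exp ((Complex.I * t) • a)‖ ^ p *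
          ‖ι (NormedSpace.exp ((Complex.I * t) • a))‖ ^ q := by
          gcongr; exact le_max_left _ _
      _ ≤ _ := mul_le_of_le_one_right (by positivity) h2
  have hind : ∀ m : ℕ, ∀ t : ℝ, |t| ≤ (k : ℝ) ^ m →
      ‖NormedSpace.exp ((Complex.I * t) • a)‖ ≤ Real.exp (D * ρ ^ m) := by
    intro m
    induction m with
    | zero =>
      intro t ht
      rw [pow_zero] at ht
      refine (norm_normedSpace_exp_le _).trans ?_
      have h1 : ‖(Complex.I * t) • a‖ ≤ M := by
        rw [norm_smul, norm_mul, Complex.norm_I, one_mul, Complex.norm_real, Real.norm_eq_abs]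
        exact (mul_le_of_le_one_left (norm_nonneg _) ht).trans haM
      have h2 : (1 + ‖(1 : A)‖) * Real.exp M ≤ Real.exp L := by
        rw [← Real.log_le_iff_le_exp (by positivity)]
        exact le_max_left _ _
      refine le_trans ?_ (h2.trans (Real.exp_le_exp.mpr ?_))
      · gcongr
      · simp only [pow_zero, mul_one]; exact le_max_left _ _
    | succ m ih =>
      intro t ht
      have ht' : |t / k| ≤ (k : ℝ) ^ m := by
        rw [abs_div, abs_of_pos hk0, div_le_iff₀ hk0, ← pow_succ]; exact ht
      have h1 := hstep (t / k)
      rw [mul_div_cancel₀ _ hk0.ne'] at h1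
      refine h1.trans ?_
      have h2 := Real.rpow_le_rpow (norm_nonneg _) (ih _ ht') hp.le
      rw [← Real.exp_mul] at h2
      calc _ ≤ C' * Real.exp (D * ρ ^ m * p) := by gcongr
        _ = Real.exp (Real.log C' + D * ρ ^ m * p) := by
          rw [Real.exp_add, Real.exp_log (by linarith)]
        _ ≤ _ := by
          refine Real.exp_le_exp.mpr ?_
          have h3 : 1 ≤ ρ ^ m := one_le_pow₀ hρ1.le
          have h4 : D * (ρ - p) * 1 ≤ D * (ρ - p) * ρ ^ m :=
            mul_le_mul_of_nonneg_left h3 (mul_nonneg hD0 (by linarith))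
          rw [pow_succ]
          nlinarith
  rcases le_total |t| 1 with ht | ht
  · refine (hind 0 t (by simpa using ht)).trans (Real.exp_le_exp.mpr ?_)
    rw [pow_zero, mul_one]
    have h1 : 0 ≤ |t| ^ Real.logb k ρ := by positivity
    have : D * 1 ≤ D * ρ := mul_le_mul_of_nonneg_left hρ1.le hD0
    nlinarith [mul_nonneg (mul_nonneg hD0 hρ0.le) h1]
  · have ht0 : 0 < |t| := by linarith
    have hlog : 0 ≤ Real.logb k |t| := Real.logb_nonneg hk1 ht
    set m := ⌈Real.logb k |t|⌉₊
    have hm : |t| ≤ (k : ℝ) ^ m := by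
      rw [← Real.rpow_natCast, ← Real.logb_le_iff_le_rpow hk1 ht0]
      exact Nat.le_ceil _
    refine (hind m t hm).trans (Real.exp_le_exp.mpr ?_)
    rw [mul_assoc]
    refine mul_le_mul_of_nonneg_left ?_ hD0
    have h1 : ρ ^ m ≤ ρ * |t| ^ Real.logb k ρ := by
      have h2 : (m : ℝ) ≤ 1 + Real.logb k |t| := by
        linarith [Nat.ceil_lt_add_one hlog]
      calc ρ ^ m = ρ ^ (m : ℝ) := (Real.rpow_natCast _ _).symm
        _ ≤ ρ ^ (1 + Real.logb k |t|) := Real.rpow_le_rpow_of_exponent_le hρ1.le h2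
        _ = ρ * ρ ^ (Real.logb k |t|) := by rw [Real.rpow_add hρ0, Real.rpow_one]
        _ = ρ * |t| ^ Real.logb k ρ := by
          congr 1
          rw [Real.rpow_def_of_pos hρ0, Real.rpow_def_of_pos ht0, Real.logb, Real.logb]
          congr 1; ring
    linarith [h1]
end DifferentialSubalgebra

theorem tsum_smul_mul_tsum_smul {E : Type*} [NormedRing E] [NormedAlgebra ℂ E] [CompleteSpace E]
    {U : ℤ → E} (hU : ∀ m n, U m * U n = U (m + n)) {x y : ℤ → ℂ}
    (hx : Summable fun n => ‖x n • U n‖) (hy : Summable fun n => ‖y n • U n‖)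
    (hx' : Summable fun n => ‖x n‖) (hy' : Summable fun n => ‖y n‖) :
    (∑' m, x m • U m) * (∑' n, y n • U n) = ∑' l, (∑' m, x m * y (l - m)) • U l := by
  rw [tsum_mul_tsum_of_summable_norm hx hy]
  have hs := summable_mul_of_summable_norm hx hy
  let e : ℤ × ℤ ≃ ℤ × ℤ :=
    { toFun := fun z => (z.2, z.1 - z.2)
      invFun := fun z => (z.1 + z.2, z.1)
      left_inv := fun z => by simp
      right_inv := fun z => by simp }
  rw [← e.tsum_eq]
  have hs' : Summable fun z : ℤ × ℤ => x (e z).1 • U (e z).1 * y (e z).2 • U (e z).2 :=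
    e.summable_iff.mpr hs
  rw [hs'.tsum_prod]
  refine tsum_congr fun l => ?_
  have hterm : ∀ m, x (e (l, m)).1 • U (e (l, m)).1 * y (e (l, m)).2 • U (e (l, m)).2 =
      (x m * y (l - m)) • U l := by
    intro m
    simp only [e, Equiv.coe_fn_mk, smul_mul_smul_comm, hU]
    congr 2
    ring
  simp only [hterm]
  refine Summable.tsum_smul_const ?_ _
  have h2 := summable_mul_of_summable_norm hx' hy'
  have h3 := e.summable_iff.mpr h2
  exact h3.prod_factor l

/-- Uniqueness of absolutely convergent Fourier series. -/
theorem eq_zero_of_tsum_mul_exp_eq_zero {d : ℤ → ℂ} (hd : Summable fun n => ‖d n‖)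
    (h : ∀ x : ℝ, ∑' n : ℤ, d n * Complex.exp (Complex.I * n * x) = 0) : d = 0 := by
  funext l
  let f : ℤ → C(ℝ, ℂ) := fun n =>
    ⟨fun t => d n * Complex.exp (Complex.I * n * t) * Complex.exp (-(Complex.I * l * t)), by fun_prop⟩
  have hfn : ∀ n t, ‖f n t‖ = ‖d n‖ := by
    intro n t
    simp only [f, ContinuousMap.coe_mk, norm_mul]
    rw [show Complex.I * n * (t : ℂ) = ((n * t : ℝ) : ℂ) * Complex.I by push_cast; ring,
      show -(Complex.I * l * (t : ℂ)) = ((-(l * t) : ℝ) : ℂ) * Complex.I by push_cast; ring,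
      Complex.norm_exp_ofReal_mul_I, Complex.norm_exp_ofReal_mul_I, mul_one, mul_one]
  have hsum : Summable fun n : ℤ =>
      ‖(f n).restrict (⟨Set.uIcc 0 (2 * Real.pi), isCompact_uIcc⟩ : TopologicalSpace.Compacts ℝ)‖ := by
    refine hd.of_nonneg_of_le (fun _ => norm_nonneg _) fun n => ?_
    rw [ContinuousMap.norm_le _ (norm_nonneg _)]
    intro t
    exact (hfn n t).le
  have hseries := intervalIntegral.tsum_intervalIntegral_eq_of_summable_norm hsum
  have h0 : ∫ t in (0 : ℝ)..(2 * Real.pi), ∑' n, f n t = 0 := by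
    rw [intervalIntegral.integral_congr (g := fun _ => (0 : ℂ))]
    · simp
    · intro t _
      simp only [f, ContinuousMap.coe_mk]
      rw [tsum_mul_right, h t, zero_mul]
  rw [h0, tsum_eq_single l] at hseries
  · have : ∀ t : ℝ, f l t = d l := fun t => by
      simp only [f, ContinuousMap.coe_mk]
      rw [mul_assoc, ← Complex.exp_add, add_neg_cancel, Complex.exp_zero, mul_one]
    simp only [this, intervalIntegral.integral_const, smul_eq_zero] at hseries
    rcases hseries with hseries | hseries
    · have := Real.pi_pos
      linarith
    · exact hseries
  · intro n hn
    have hnc : ((n - l : ℤ) : ℂ) ≠ 0 := by exact_mod_cast sub_ne_zero.mpr hn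
    have : ∀ t : ℝ, f n t = d n * Complex.exp (Complex.I * (n - l : ℤ) * t) := fun t => by
      simp only [f, ContinuousMap.coe_mk]
      rw [mul_assoc, ← Complex.exp_add]
      congr 2
      push_cast; ring
    simp only [this, intervalIntegral.integral_const_mul]
    rw [integral_exp_mul_complex (mul_ne_zero Complex.I_ne_zero hnc)]
    have : Complex.I * (n - l : ℤ) * ((2 * Real.pi : ℝ) : ℂ) =
        ((n - l : ℤ) : ℂ) * (2 * Real.pi * Complex.I) := by push_cast; ring
    rw [this, Complex.exp_int_mul_two_pi_mul_I]
    simp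

theorem cos_add_lt_cos_sub {u v δ₁ δ₂ : ℝ} (h₁ : 0 ≤ δ₁) (h₂ : 0 ≤ δ₂) (h : δ₁ + δ₂ ≤ Real.pi)
    (hu : Real.cos δ₁ < Real.cos u) (hv : Real.cos δ₂ < Real.cos v) :
    Real.cos (δ₁ + δ₂) < Real.cos (u - v) := by
  have key : ∀ w δ : ℝ, 0 ≤ δ → δ ≤ Real.pi → Real.cos δ < Real.cos w →
      Real.arccos (Real.cos w) < δ ∧ Real.sin (Real.arccos (Real.cos w)) = |Real.sin w| := by
    intro w δ h0 hπ hlt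
    constructor
    · have := Real.arccos_lt_arccos (Real.neg_one_le_cos δ) hlt (Real.cos_le_one w)
      rwa [Real.arccos_cos h0 hπ] at this
    · rw [Real.sin_arccos, ← Real.abs_sin_eq_sqrt_one_sub_cos_sq]
  obtain ⟨hα, hsα⟩ := key u δ₁ h₁ (by linarith) hu
  obtain ⟨hβ, hsβ⟩ := key v δ₂ h₂ (by linarith) hv
  have h3 : Real.cos (δ₁ + δ₂) < Real.cos (Real.arccos (Real.cos u) + Real.arccos (Real.cos v)) :=
    Real.cos_lt_cos_of_nonneg_of_le_pi
      (add_nonneg (Real.arccos_nonneg _) (Real.arccos_nonneg _)) h (by linarith)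
  refine h3.trans_le ?_
  rw [Real.cos_add, Real.cos_sub, hsα, hsβ,
    Real.cos_arccos (Real.neg_one_le_cos _) (Real.cos_le_one _),
    Real.cos_arccos (Real.neg_one_le_cos _) (Real.cos_le_one _), ← abs_mul]
  linarith [neg_abs_le (Real.sin u * Real.sin v)]

theorem exp_rpow_growth_lt_exp {γ β K D : ℝ} (hγ0 : 0 < γ) (hγ : γ < 1) (hβ : 0 < β) :
    ∃ T : ℝ, 0 < T ∧ K * Real.exp (D * (1 + T ^ γ)) < Real.exp (β * T) := by
  obtain ⟨M, hM⟩ := exists_bound_exp_rpow_sub (K := D) (κ := β / 2) hγ0 hγ (by positivity)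
  obtain ⟨T, hT⟩ : ∃ T : ℝ, 0 < T ∧ |K| * Real.exp (D + M) < Real.exp (β / 2 * T) := by
    have h1 : Tendsto (fun T : ℝ => Real.exp (β / 2 * T)) atTop atTop :=
      Real.tendsto_exp_atTop.comp (tendsto_id.const_mul_atTop (by positivity))
    exact ((eventually_gt_atTop 0).and (h1.eventually_gt_atTop _)).exists
  refine ⟨T, hT.1, ?_⟩
  have h2 := hM T hT.1.le
  rw [Real.rpow_one] at h2
  calc K * Real.exp (D * (1 + T ^ γ)) ≤ |K| * Real.exp (D * (1 + T ^ γ)) :=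
        mul_le_mul_of_nonneg_right (le_abs_self K) (Real.exp_pos _).le
    _ ≤ |K| * Real.exp (D + M + β / 2 * T) := by gcongr; linarith
    _ = |K| * Real.exp (D + M) * Real.exp (β / 2 * T) := by rw [Real.exp_add]; ring
    _ < Real.exp (β / 2 * T) * Real.exp (β / 2 * T) :=
        mul_lt_mul_of_pos_right hT.2 (Real.exp_pos _)
    _ = Real.exp (β * T) := by rw [← Real.exp_add]; ring_nf

section FunctionalCalculus

variable {E : Type*} [NormedRing E] [NormedAlgebra ℂ E]

/-- The value at `a` of the periodic function `x ↦ ∑ c n * exp (i n (x - μ))`. -/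
noncomputable def periodicCalculus (c : ℤ → ℝ) (μ : ℝ) (a : E) : E :=
  ∑' n : ℤ, ((c n : ℂ) * Complex.exp (-(Complex.I * n * μ))) • NormedSpace.exp ((Complex.I * n) • a)

theorem norm_periodic_coefficient (c : ℤ → ℝ) (hc : ∀ n, 0 ≤ c n) (μ : ℝ) (n : ℤ) :
    ‖(c n : ℂ) * Complex.exp (-(Complex.I * n * μ))‖ = c n := by
  rw [norm_mul, show -(Complex.I * n * (μ : ℂ)) = ((-(n * μ) : ℝ) : ℂ) * Complex.I by push_cast; ring,
    Complex.norm_exp_ofReal_mul_I, mul_one, Complex.norm_real, Real.norm_eq_abs, abs_of_nonneg (hc n)]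

theorem summable_periodicCalculus {γ D : ℝ} {a : E}
    (hg : ∀ t : ℝ, ‖NormedSpace.exp ((Complex.I * t) • a)‖ ≤ Real.exp (D * (1 + |t| ^ γ)))
    {c : ℤ → ℝ} (hc : ∀ n, 0 ≤ c n)
    (hs : ∀ K : ℝ, Summable fun n : ℤ => c n * Real.exp (K * |(n : ℝ)| ^ γ)) (μ : ℝ) :
    Summable fun n : ℤ => ‖((c n : ℂ) * Complex.exp (-(Complex.I * n * μ))) •
      NormedSpace.exp ((Complex.I * n) • a)‖ := by
  refine ((hs D).mul_left (Real.exp D)).of_nonneg_of_le (fun _ => norm_nonneg _) fun n => ?_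
  rw [norm_smul, norm_periodic_coefficient c hc]
  have h := hg n
  rw [Complex.ofReal_intCast] at h
  calc _ ≤ c n * Real.exp (D * (1 + |(n : ℝ)| ^ γ)) := mul_le_mul_of_nonneg_left h (hc n)
    _ = _ := by rw [mul_add, mul_one, Real.exp_add]; ring

variable [CompleteSpace E]

theorem periodicCalculus_mul_eq_zero {γ D : ℝ} {a : E}
    (hg : ∀ t : ℝ, ‖NormedSpace.exp ((Complex.I * t) • a)‖ ≤ Real.exp (D * (1 + |t| ^ γ)))
    {c₁ c₂ : ℤ → ℝ} (hc₁ : ∀ n, 0 ≤ c₁ n) (hc₂ : ∀ n, 0 ≤ c₂ n)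
    (hs₁ : ∀ K : ℝ, Summable fun n : ℤ => c₁ n * Real.exp (K * |(n : ℝ)| ^ γ))
    (hs₂ : ∀ K : ℝ, Summable fun n : ℤ => c₂ n * Real.exp (K * |(n : ℝ)| ^ γ)) {μ₁ μ₂ : ℝ}
    (h : ∀ x : ℝ, (∑' n : ℤ, (c₁ n : ℂ) * Complex.exp (Complex.I * n * (x - μ₁ : ℝ)) = 0) ∨
      ∑' n : ℤ, (c₂ n : ℂ) * Complex.exp (Complex.I * n * (x - μ₂ : ℝ)) = 0) :
    periodicCalculus c₁ μ₁ a * periodicCalculus c₂ μ₂ a = 0 := by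
  set x : ℤ → ℂ := fun n => (c₁ n : ℂ) * Complex.exp (-(Complex.I * n * μ₁)) with hx
  set y : ℤ → ℂ := fun n => (c₂ n : ℂ) * Complex.exp (-(Complex.I * n * μ₂)) with hy
  have hxs : Summable fun n => ‖x n‖ := by
    have := hs₁ 0
    simp only [zero_mul, Real.exp_zero, mul_one] at this
    simpa only [hx, norm_periodic_coefficient c₁ hc₁] using this
  have hys : Summable fun n => ‖y n‖ := by
    have := hs₂ 0
    simp only [zero_mul, Real.exp_zero, mul_one] at this
    simpa only [hy, norm_periodic_coefficient c₂ hc₂] using this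
  have hconv : (fun l => ∑' m, x m * y (l - m)) = 0 := by
    refine eq_zero_of_tsum_mul_exp_eq_zero ?_ fun t => ?_
    · have hp := (summable_mul_of_summable_norm hxs.norm hys.norm)
      let e : ℤ × ℤ ≃ ℤ × ℤ :=
        { toFun := fun z => (z.2, z.1 - z.2)
          invFun := fun z => (z.1 + z.2, z.1)
          left_inv := fun z => by simp
          right_inv := fun z => by simp }
      have hp' := (e.summable_iff.mpr hp)
      refine hp'.prod.of_nonneg_of_le (fun _ => norm_nonneg _) fun l => ?_
      have hl := hp'.prod_factor l
      refine (norm_tsum_le_tsum_norm ?_).trans_eq ?_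
      · simpa [e] using hl
      · simp [e]
    · let U : ℤ → ℂ := fun n => Complex.exp (Complex.I * n * t)
      have hU : ∀ m n, U m * U n = U (m + n) := fun m n => by
        simp only [U, ← Complex.exp_add]; congr 1; push_cast; ring
      have hU1 : ∀ n, ‖U n‖ = 1 := fun n => by
        simp only [U]
        rw [show Complex.I * n * (t : ℂ) = ((n * t : ℝ) : ℂ) * Complex.I by push_cast; ring,
          Complex.norm_exp_ofReal_mul_I]
      have h1 := tsum_smul_mul_tsum_smul hU (x := x) (y := y)
        (by simpa [hU1] using hxs) (by simpa [hU1] using hys) hxs hys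
      have h2 : ∀ (c : ℤ → ℝ) (μ : ℝ) (n : ℤ), ((c n : ℂ) * Complex.exp (-(Complex.I * n * μ))) • U n =
          (c n : ℂ) * Complex.exp (Complex.I * n * (t - μ : ℝ)) := fun c μ n => by
        simp only [U, smul_eq_mul]
        rw [mul_assoc, ← Complex.exp_add]; congr 2; push_cast; ring
      simp only [hx, hy, h2] at h1
      simp only [← smul_eq_mul]
      refine h1.symm.trans ?_
      rcases h t with h | h <;> rw [h] <;> simp
  have hU : ∀ m n : ℤ, NormedSpace.exp ((Complex.I * m) • a) * NormedSpace.exp ((Complex.I * n) • a) =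
      NormedSpace.exp ((Complex.I * ((m + n : ℤ) : ℂ)) • a) := fun m n => by
    rw [exp_smul_mul_exp_smul]; congr 2; push_cast; ring
  have h1 := tsum_smul_mul_tsum_smul (U := fun n : ℤ => NormedSpace.exp ((Complex.I * n) • a)) hU
    (summable_periodicCalculus hg hc₁ hs₁ μ₁) (summable_periodicCalculus hg hc₂ hs₂ μ₂) hxs hys
  refine h1.trans ?_
  have h3 : ∀ l, ∑' m, x m * y (l - m) = 0 := fun l => congrFun hconv l
  simp only [hx, hy] at h3
  simp only [h3, zero_smul, tsum_zero]

theorem character_exp {ψ : E →ₐ[ℂ] ℂ} (hψ : Continuous ψ) (a : E) (z : ℂ) :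
    ψ (NormedSpace.exp (z • a)) = Complex.exp (z * ψ a) := by
  let _ : NormedAlgebra ℚ E := NormedAlgebra.restrictScalars ℚ ℂ E
  rw [NormedSpace.map_exp ψ hψ, map_smul, smul_eq_mul, Complex.exp_eq_exp_ℂ]

theorem character_periodicCalculus_ne_zero {γ D : ℝ} {a : E}
    (hg : ∀ t : ℝ, ‖NormedSpace.exp ((Complex.I * t) • a)‖ ≤ Real.exp (D * (1 + |t| ^ γ)))
    {c : ℤ → ℝ} (hc : ∀ n, 0 ≤ c n) (hc0 : 0 < c 0)
    (hs : ∀ K : ℝ, Summable fun n : ℤ => c n * Real.exp (K * |(n : ℝ)| ^ γ)) {μ : ℝ}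
    {ψ : E →ₐ[ℂ] ℂ} (hψ : Continuous ψ) (hψa : ψ a = μ) :
    ψ (periodicCalculus c μ a) ≠ 0 := by
  have h1 := (summable_periodicCalculus hg hc hs μ).of_norm.hasSum.map ψ hψ
  have h2 : (ψ ∘ fun n : ℤ => ((c n : ℂ) * Complex.exp (-(Complex.I * n * μ))) •
      NormedSpace.exp ((Complex.I * n) • a)) = fun n => ((c n : ℝ) : ℂ) := by
    funext n
    rw [Function.comp_apply, map_smul, character_exp hψ, hψa, smul_eq_mul, mul_assoc,
      ← Complex.exp_add, neg_add_cancel, Complex.exp_zero, mul_one]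
  rw [h2] at h1
  have hsum : Summable c := by simpa using hs 0
  have h3 : ψ (periodicCalculus c μ a) = ((∑' n, c n : ℝ) : ℂ) := by
    rw [Complex.ofReal_tsum]; exact h1.tsum_eq.symm
  rw [h3]
  have : 0 < ∑' n, c n := hsum.tsum_pos hc 0 hc0
  exact_mod_cast this.ne'

theorem character_im_eq_zero {γ D : ℝ} (hγ0 : 0 < γ) (hγ : γ < 1) {a : E}
    (hg : ∀ t : ℝ, ‖NormedSpace.exp ((Complex.I * t) • a)‖ ≤ Real.exp (D * (1 + |t| ^ γ)))
    {ψ : E →ₐ[ℂ] ℂ} (hψ : Continuous ψ) : (ψ a).im = 0 := by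
  by_contra him
  let Ψ : E →L[ℂ] ℂ := ⟨ψ.toLinearMap, hψ⟩
  obtain ⟨T, hT0, hT⟩ := exp_rpow_growth_lt_exp (K := ‖Ψ‖) (D := D) hγ0 hγ (abs_pos.mpr him)
  have key : ∀ t : ℝ, |t| = T → Real.exp (-(t * (ψ a).im)) ≤ ‖Ψ‖ * Real.exp (D * (1 + T ^ γ)) := by
    intro t ht
    have h1 : ‖ψ (NormedSpace.exp ((Complex.I * t) • a))‖ ≤ _ := Ψ.le_opNorm _
    rw [character_exp hψ, Complex.norm_exp] at h1
    have h2 := hg t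
    rw [ht] at h2
    refine le_trans (le_of_eq ?_) (h1.trans (mul_le_mul_of_nonneg_left h2 (norm_nonneg _)))
    congr 1
    simp
  rcases lt_or_gt_of_ne him with h | h
  · have := key T (abs_of_pos hT0)
    rw [abs_of_neg h] at hT
    rw [show -(T * (ψ a).im) = -(ψ a).im * T by ring] at this
    linarith
  · have := key (-T) (by rw [abs_neg, abs_of_pos hT0])
    rw [abs_of_pos h] at hT
    rw [show -(-T * (ψ a).im) = (ψ a).im * T by ring] at this
    linarith

end FunctionalCalculus

theorem Set.Infinite.exists_separated_seq {S : Set ℝ} (hS : S.Infinite) :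
    ∃ μ δ : ℕ → ℝ, (∀ n, μ n ∈ S) ∧ (∀ n, 0 < δ n) ∧
      ∀ m n, m ≠ n → δ m + δ n ≤ |μ m - μ n| := by
  have : Infinite S := hS.to_subtype
  obtain ⟨U, hUinf, hUo, hUd⟩ := exists_seq_infinite_isOpen_pairwise_disjoint S
  choose x hx using fun n => (hUinf n).nonempty
  choose ε hε0 hε using fun n => Metric.isOpen_iff.mp (hUo n) (x n) (hx n)
  have key : ∀ m n, m ≠ n → ε m ≤ dist (x n) (x m) := by
    intro m n hmn
    by_contra! h
    exact Set.disjoint_left.mp (hUd hmn) (hε m h) (hx n)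
  refine ⟨fun n => x n, fun n => ε n / 2, fun n => (x n).2, fun n => half_pos (hε0 n),
    fun m n hmn => ?_⟩
  have h1 := key m n hmn
  have h2 := key n m hmn.symm
  rw [dist_comm] at h1
  rw [Subtype.dist_eq, Real.dist_eq] at h1 h2
  linarith

theorem Ideal.exists_character_of_mem_spectrum_mk {E : Type*} [NormedCommRing E]
    [NormedAlgebra ℂ E] [CompleteSpace E] (I : Ideal E) [IsClosed (I : Set E)] {a : E} {z : ℂ}
    (hz : z ∈ spectrum ℂ (Ideal.Quotient.mk I a)) :
    ∃ ψ : E →ₐ[ℂ] ℂ, Continuous ψ ∧ ψ a = z ∧ ∀ x ∈ I, ψ x = 0 := by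
  have : CompleteSpace (E ⧸ I) := inferInstance
  obtain ⟨f, hf⟩ := WeakDual.CharacterSpace.mem_spectrum_iff_exists.mp hz
  refine ⟨(WeakDual.CharacterSpace.toAlgHom f).comp (Ideal.Quotient.mkₐ ℂ I), ?_, hf, ?_⟩
  · exact (map_continuous f).comp continuous_quotient_mk'
  · intro x hx
    have : Ideal.Quotient.mk I x = 0 := Ideal.Quotient.eq_zero_iff_mem.mpr hx
    change f (Ideal.Quotient.mk I x) = 0
    rw [this, map_zero]

theorem spectrum_mk_finite_real {E : Type*} [NormedCommRing E]
    [NormedAlgebra ℂ E] [CompleteSpace E] (I : Ideal E) [IsClosed (I : Set E)] {a : E}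
    {γ D : ℝ} (hγ0 : 0 < γ) (hγ : γ < 1) (hD : 0 ≤ D)
    (hg : ∀ t : ℝ, ‖NormedSpace.exp ((Complex.I * t) • a)‖ ≤ Real.exp (D * (1 + |t| ^ γ)))
    (horth : ∀ g : ℕ → E, (∀ m n, m ≠ n → g m * g n = 0) → ∃ n, g n * g n ∈ I) :
    ∃ Λ : Finset ℝ, ∀ z ∈ spectrum ℂ (Ideal.Quotient.mk I a), ∃ l ∈ Λ, z = (l : ℝ) := by
  set S : Set ℝ := {l : ℝ | (l : ℂ) ∈ spectrum ℂ (Ideal.Quotient.mk I a)} with hSdef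
  have hreal : ∀ z ∈ spectrum ℂ (Ideal.Quotient.mk I a), z = (z.re : ℝ) := by
    intro z hz
    obtain ⟨ψ, hψ, hψa, -⟩ := I.exists_character_of_mem_spectrum_mk hz
    have := character_im_eq_zero hγ0 hγ hg hψ
    rw [hψa] at this
    apply Complex.ext <;> simp [this]
  suffices hfin : S.Finite by
    refine ⟨hfin.toFinset, fun z hz => ⟨z.re, ?_, hreal z hz⟩⟩
    rw [Set.Finite.mem_toFinset]
    change ((z.re : ℝ) : ℂ) ∈ spectrum ℂ (Ideal.Quotient.mk I a)
    rw [← hreal z hz]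
    exact hz
  by_contra hinf
  obtain ⟨μ, δ, hμ, hδ, hsep⟩ := Set.Infinite.exists_separated_seq hinf
  choose ψ hψ hψa hψI using fun n => I.exists_character_of_mem_spectrum_mk (hμ n)
  have hC : CompleteSpace (E ⧸ I) := inferInstance
  obtain ⟨R, hR0, hR⟩ : ∃ R : ℝ, 0 ≤ R ∧ ∀ n, |μ n| ≤ R := by
    refine ⟨‖Ideal.Quotient.mk I a‖ * ‖(1 : E ⧸ I)‖, by positivity, fun n => ?_⟩
    have := spectrum.norm_le_norm_mul_of_mem (hμ n)
    simpa using this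
  set s : ℝ := 1 / (R + 1) with hs
  have hs0 : 0 < s := by positivity
  have hs1 : s ≤ 1 := by rw [hs, div_le_one (by positivity)]; linarith
  have hsR : s * R ≤ 1 := by
    rw [hs, one_div_mul_eq_div, div_le_one (by positivity)]; linarith
  have hg' : ∀ t : ℝ, ‖NormedSpace.exp ((Complex.I * t) • ((s : ℂ) • a))‖ ≤
      Real.exp (D * (1 + |t| ^ γ)) := by
    intro t
    rw [smul_smul, show Complex.I * t * (s : ℂ) = Complex.I * ((t * s : ℝ) : ℂ) by push_cast; ring]
    refine (hg (t * s)).trans (Real.exp_le_exp.mpr ?_)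
    have : |t * s| ≤ |t| := by
      rw [abs_mul, abs_of_pos hs0]; exact mul_le_of_le_one_right (abs_nonneg _) hs1
    gcongr
  have hdist : ∀ m n, s * |μ m - μ n| ≤ 2 := by
    intro m n
    have h1 : |μ m - μ n| ≤ R + R := (abs_sub _ _).trans (add_le_add (hR m) (hR n))
    calc _ ≤ s * (R + R) := mul_le_mul_of_nonneg_left h1 hs0.le
      _ ≤ 2 := by linarith
  have hπ : 2 < Real.pi := by linarith [Real.pi_gt_three]
  have hsδ : ∀ n, s * δ n ≤ Real.pi := by
    intro n
    have h1 := hsep n (n + 1) (by omega)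
    have h2 : δ n ≤ |μ n - μ (n + 1)| := by linarith [hδ (n + 1)]
    exact (mul_le_mul_of_nonneg_left h2 hs0.le).trans ((hdist _ _).trans hπ.le)
  choose c hc hc0 hcs hcz using fun n =>
    exists_bump_coefficients hγ0 hγ (mul_pos hs0 (hδ n)) (hsδ n)
  have hmul : ∀ m n, m ≠ n → periodicCalculus (c m) (s * μ m) ((s : ℂ) • a) *
      periodicCalculus (c n) (s * μ n) ((s : ℂ) • a) = 0 := by
    intro m n hmn
    refine periodicCalculus_mul_eq_zero hg' (hc m) (hc n) (hcs m) (hcs n) fun x => ?_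
    by_cases h1 : Real.cos (x - s * μ m) ≤ Real.cos (s * δ m)
    · exact Or.inl (hcz m _ h1)
    by_cases h2 : Real.cos (x - s * μ n) ≤ Real.cos (s * δ n)
    · exact Or.inr (hcz n _ h2)
    exfalso
    push Not at h1 h2
    have h4 : s * δ m + s * δ n ≤ s * |μ m - μ n| := by
      rw [← mul_add]; exact mul_le_mul_of_nonneg_left (hsep m n hmn) hs0.le
    have h3 := cos_add_lt_cos_sub (mul_pos hs0 (hδ m)).le (mul_pos hs0 (hδ n)).le
      (h4.trans ((hdist m n).trans hπ.le)) h1 h2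
    rw [show x - s * μ m - (x - s * μ n) = -(s * (μ m - μ n)) by ring, Real.cos_neg,
      ← Real.cos_abs (s * (μ m - μ n)), abs_mul, abs_of_pos hs0] at h3
    have h5 := Real.cos_le_cos_of_nonneg_of_le_pi
      (add_pos (mul_pos hs0 (hδ m)) (mul_pos hs0 (hδ n))).le ((hdist m n).trans hπ.le) h4
    linarith
  obtain ⟨n, hn⟩ := horth (fun n => periodicCalculus (c n) (s * μ n) ((s : ℂ) • a)) hmul
  have h1 := hψI n _ hn
  rw [map_mul, mul_self_eq_zero] at h1
  refine character_periodicCalculus_ne_zero hg' (hc n) (hc0 n) (hcs n) (hψ n) ?_ h1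
  rw [map_smul, hψa]; simp

theorem exists_norm_pow_le_of_spectralRadius_lt {Q : Type*} [NormedRing Q] [NormedAlgebra ℂ Q]
    [CompleteSpace Q] {b : Q} {ε : ℝ} (hε : 0 < ε)
    (h : spectralRadius ℂ b < ENNReal.ofReal ε) : ∃ K : ℝ, ∀ m : ℕ, ‖b ^ m‖ ≤ K * ε ^ m := by
  have ht := spectrum.pow_nnnorm_pow_one_div_tendsto_nhds_spectralRadius b
  obtain ⟨N, hN⟩ := eventually_atTop.mp (ht.eventually_lt_const h)
  have hlarge : ∀ m, N + 1 ≤ m → ‖b ^ m‖ ≤ ε ^ m := by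
    intro m hm
    have hm0 : (0 : ℝ) < m := by exact_mod_cast (by omega : 0 < m)
    have h1 := hN m (by omega)
    rw [← ENNReal.coe_rpow_of_nonneg _ (by positivity), ENNReal.ofReal, ENNReal.coe_lt_coe,
      ← NNReal.coe_lt_coe, NNReal.coe_rpow, Real.coe_toNNReal _ hε.le, coe_nnnorm] at h1
    calc ‖b ^ m‖ = (‖b ^ m‖ ^ (1 / (m : ℝ))) ^ m := by
          rw [← Real.rpow_natCast, ← Real.rpow_mul (norm_nonneg _), one_div_mul_cancel hm0.ne',
            Real.rpow_one]
      _ ≤ ε ^ m := pow_le_pow_left₀ (by positivity) h1.le m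
  refine ⟨1 + ∑ i ∈ Finset.range (N + 1), ‖b ^ i‖ / ε ^ i, fun m => ?_⟩
  have hs : 0 ≤ ∑ i ∈ Finset.range (N + 1), ‖b ^ i‖ / ε ^ i :=
    Finset.sum_nonneg fun _ _ => by positivity
  have hεm : 0 < ε ^ m := by positivity
  rcases le_or_gt (N + 1) m with hm | hm
  · refine (hlarge m hm).trans (le_mul_of_one_le_left hεm.le (by linarith))
  · have h1 : ‖b ^ m‖ / ε ^ m ≤ ∑ i ∈ Finset.range (N + 1), ‖b ^ i‖ / ε ^ i :=
      Finset.single_le_sum (f := fun i => ‖b ^ i‖ / ε ^ i) (fun _ _ => by positivity)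
        (Finset.mem_range.mpr hm)
    rw [div_le_iff₀ hεm] at h1
    nlinarith

theorem Ideal.exists_dist_pow_le_of_spectrum {E : Type*} [NormedCommRing E]
    [NormedAlgebra ℂ E] [CompleteSpace E] (I : Ideal E) [IsClosed (I : Set E)] {h : E}
    (hspec : ∀ z ∈ spectrum ℂ (Ideal.Quotient.mk I h), z = 0) {ε : ℝ} (hε : 0 < ε) :
    ∃ K : ℝ, ∀ m : ℕ, ∃ x ∈ I, ‖h ^ m - x‖ ≤ K * ε ^ m := by
  have hC : CompleteSpace (E ⧸ I) := inferInstance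
  have hr : spectralRadius ℂ (Ideal.Quotient.mk I h) < ENNReal.ofReal ε := by
    refine lt_of_le_of_lt ?_ (ENNReal.ofReal_pos.mpr hε)
    refine iSup₂_le fun z hz => ?_
    rw [hspec z hz]; simp
  obtain ⟨K, hK⟩ := exists_norm_pow_le_of_spectralRadius_lt hε hr
  refine ⟨K + 1, fun m => ?_⟩
  have hεm : 0 < ε ^ m := by positivity
  obtain ⟨y, hy, hyn⟩ := Ideal.Quotient.norm_mk_lt (I := I) (Ideal.Quotient.mk I (h ^ m)) hεm
  refine ⟨h ^ m - y, ?_, ?_⟩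
  · rw [← Ideal.Quotient.eq, hy]
  · rw [sub_sub_cancel]
    have := hK m
    rw [map_pow] at hyn
    linarith

theorem exists_real_polynomial_quasinilpotent_mod {A : Type*} [NormedRing A] [NormedAlgebra ℂ A]
    [CompleteSpace A] (I : Submodule ℂ A) (hI : IsClosed (I : Set A))
    (hIl : ∀ a x : A, x ∈ I → a * x ∈ I) {a : A}
    {γ D : ℝ} (hγ0 : 0 < γ) (hγ : γ < 1) (hD : 0 ≤ D)
    (hg : ∀ t : ℝ, ‖NormedSpace.exp ((Complex.I * t) • a)‖ ≤ Real.exp (D * (1 + |t| ^ γ)))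
    (horth : ∀ g : ℕ → A, (∀ m n, m ≠ n → g m * g n = 0) → ∃ n, g n * g n ∈ I) :
    ∃ Λ : Finset ℝ, ∀ ε : ℝ, 0 < ε → ∃ K : ℝ, ∀ m : ℕ, ∃ x ∈ I,
      ‖(Λ.toList.map fun l : ℝ => a - algebraMap ℂ A l).prod ^ m - x‖ ≤ K * ε ^ m := by
  let E := Algebra.elemental ℂ a
  let _ : NormedCommRing E :=
    { (inferInstance : NormedRing E) with mul_comm := fun x y => mul_comm x y }
  let aE : E := ⟨a, Algebra.elemental.self_mem ℂ a⟩
  let J : Ideal E :=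
    { carrier := {x | (x : A) ∈ I}
      add_mem' := fun {x y} hx hy => I.add_mem hx hy
      zero_mem' := I.zero_mem
      smul_mem' := fun c x hx => hIl c x hx }
  have hJ : IsClosed (J : Set E) := hI.preimage continuous_subtype_val
  have hexp : ∀ z : ℂ, ((NormedSpace.exp (z • aE) : E) : A) = NormedSpace.exp (z • a) := by
    intro z
    let _ : NormedAlgebra ℚ E := NormedAlgebra.restrictScalars ℚ ℂ E
    let _ : NormedAlgebra ℚ A := NormedAlgebra.restrictScalars ℚ ℂ A
    exact NormedSpace.map_exp E.val continuous_subtype_val (z • aE)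
  have hgE : ∀ t : ℝ, ‖NormedSpace.exp ((Complex.I * t) • aE)‖ ≤ Real.exp (D * (1 + |t| ^ γ)) := by
    intro t
    have := hg t
    rw [← hexp] at this
    exact this
  obtain ⟨Λ, hΛ⟩ := spectrum_mk_finite_real J hγ0 hγ hD hgE (by
    intro g hgo
    exact horth (fun n => g n) fun m n hmn => by
      rw [← Subalgebra.coe_mul, hgo m n hmn, Subalgebra.coe_zero])
  let hE : E := (Λ.toList.map fun l : ℝ => aE - algebraMap ℂ E l).prod
  have hhE : (hE : A) = (Λ.toList.map fun l : ℝ => a - algebraMap ℂ A l).prod := by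
    have := map_list_prod E.val (Λ.toList.map fun l : ℝ => aE - algebraMap ℂ E l)
    refine this.trans ?_
    rw [List.map_map]
    rfl
  have hspec : ∀ z ∈ spectrum ℂ (Ideal.Quotient.mk J hE), z = 0 := by
    intro z hz
    have hC : CompleteSpace (E ⧸ J) := inferInstance
    obtain ⟨f, hf⟩ := WeakDual.CharacterSpace.mem_spectrum_iff_exists.mp hz
    have ha : f (Ideal.Quotient.mk J aE) ∈ spectrum ℂ (Ideal.Quotient.mk J aE) :=
      WeakDual.CharacterSpace.mem_spectrum_iff_exists.mpr ⟨f, rfl⟩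
    obtain ⟨l, hl, hal⟩ := hΛ _ ha
    let F : E →ₐ[ℂ] ℂ := (WeakDual.CharacterSpace.toAlgHom f).comp (Ideal.Quotient.mkₐ ℂ J)
    have hFa : F aE = l := hal
    have hFh : F hE = z := hf
    rw [← hFh, map_list_prod, List.prod_eq_zero_iff, List.map_map, List.mem_map]
    refine ⟨l, Finset.mem_toList.mpr hl, ?_⟩
    rw [Function.comp_apply, map_sub, hFa, AlgHom.commutes]
    simp
  refine ⟨Λ, fun ε hε => ?_⟩
  obtain ⟨K, hK⟩ := J.exists_dist_pow_le_of_spectrum hspec hε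
  refine ⟨K, fun m => ?_⟩
  obtain ⟨x, hx, hxn⟩ := hK m
  refine ⟨x, hx, ?_⟩
  rw [← hhE]
  exact hxn

theorem NonUnitalStarSubalgebra.exists_approximate_unit {B : Type*} [NonUnitalCStarAlgebra B]
    (K : NonUnitalStarSubalgebra ℂ B) (hK : IsClosed (K : Set B)) {x : B} (hx : x ∈ K) {ε : ℝ}
    (hε : 0 < ε) : ∃ e ∈ K, star e = e ∧ ‖e‖ ≤ 1 ∧ ‖x - x * e‖ ≤ ε := by
  have := hK
  let _ := CStarAlgebra.spectralOrder K
  let _ := CStarAlgebra.spectralOrderedRing K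
  have hu := CStarAlgebra.increasingApproximateUnit K
  have hne := hu.neBot
  have h1 := (Metric.tendsto_nhds.mp (hu.tendsto_mul_left ⟨x, hx⟩)) ε hε
  obtain ⟨e, he1, he2, he3⟩ := (h1.and (hu.eventually_norm.and hu.eventually_star_eq)).exists
  refine ⟨e, e.2, congrArg Subtype.val he3, he2, ?_⟩
  rw [dist_comm, dist_eq_norm] at he1
  exact he1.le

theorem NonUnitalStarSubalgebra.infDist_sq_le {B : Type*} [NonUnitalCStarAlgebra B]
    (K : NonUnitalStarSubalgebra ℂ B) (hK : IsClosed (K : Set B)) {b : B}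
    (hb : ∀ x ∈ K, b * x ∈ K) :
    Metric.infDist b K ^ 2 ≤ 4 * Metric.infDist (star b * b) K := by
  refine le_of_forall_pos_le_add fun ε hε => ?_
  have hne : (K : Set B).Nonempty := ⟨0, K.zero_mem⟩
  obtain ⟨y, hy, hyd⟩ := (Metric.infDist_lt_iff hne).mp
    (lt_add_of_pos_right (Metric.infDist (star b * b) K) (by positivity : 0 < ε / 8))
  obtain ⟨e, he, hes, hen, hye⟩ := K.exists_approximate_unit hK hy (by positivity : 0 < ε / 4)
  set d := star b * b with hd
  have h1 : Metric.infDist b K ≤ ‖b - b * e‖ := by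
    rw [← dist_eq_norm]
    exact Metric.infDist_le_dist_of_mem (hb e he)
  have h2 : ‖b - b * e‖ ^ 2 = ‖(d - y) - (d - y) * e - e * (d - y) + e * ((d - y) * e)
      + ((y - y * e) - e * (y - y * e))‖ := by
    rw [sq, ← CStarRing.norm_star_mul_self, star_sub, star_mul, hes]
    congr 1
    simp only [hd, sub_mul, mul_sub, mul_assoc]
    abel
  have hr : ‖d - y‖ ≤ Metric.infDist d K + ε / 8 := by rw [← dist_eq_norm]; exact hyd.le
  have hr1 : ‖(d - y) * e‖ ≤ ‖d - y‖ :=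
    (norm_mul_le _ _).trans (mul_le_of_le_one_right (norm_nonneg _) hen)
  have hl : ∀ z : B, ‖e * z‖ ≤ ‖z‖ := fun z =>
    (norm_mul_le _ _).trans (mul_le_of_le_one_left (norm_nonneg _) hen)
  have h3 : ‖(d - y) - (d - y) * e - e * (d - y) + e * ((d - y) * e)
      + ((y - y * e) - e * (y - y * e))‖ ≤ 4 * ‖d - y‖ + 2 * ‖y - y * e‖ := by
    have := hl (d - y)
    have := hl ((d - y) * e)
    have := hl (y - y * e)
    have t1 := norm_add_le ((d - y) - (d - y) * e - e * (d - y) + e * ((d - y) * e))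
      ((y - y * e) - e * (y - y * e))
    have t2 := norm_add_le ((d - y) - (d - y) * e - e * (d - y)) (e * ((d - y) * e))
    have t3 := norm_sub_le ((d - y) - (d - y) * e) (e * (d - y))
    have t4 := norm_sub_le (d - y) ((d - y) * e)
    have t5 := norm_sub_le (y - y * e) (e * (y - y * e))
    linarith
  calc Metric.infDist b K ^ 2 ≤ ‖b - b * e‖ ^ 2 := pow_le_pow_left₀ Metric.infDist_nonneg h1 2
    _ ≤ 4 * ‖d - y‖ + 2 * ‖y - y * e‖ := h2.trans_le h3
    _ ≤ 4 * Metric.infDist d K + ε := by linarith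

theorem NonUnitalStarSubalgebra.mem_of_star_mul_self_mem {B : Type*} [NonUnitalCStarAlgebra B]
    (K : NonUnitalStarSubalgebra ℂ B) (hK : IsClosed (K : Set B)) {b : B}
    (hb : ∀ x ∈ K, b * x ∈ K) (h : star b * b ∈ K) : b ∈ K := by
  have h1 := K.infDist_sq_le hK hb
  rw [Metric.infDist_zero_of_mem (s := (K : Set B)) h, mul_zero] at h1
  have h2 : Metric.infDist b K = 0 := pow_eq_zero_iff two_ne_zero |>.mp (le_antisymm h1 (sq_nonneg _))
  exact (hK.mem_iff_infDist_zero ⟨0, K.zero_mem⟩).mpr h2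

theorem NonUnitalStarSubalgebra.mem_of_infDist_star_mul_self_iterate_le {B : Type*}
    [NonUnitalCStarAlgebra B]
    (K : NonUnitalStarSubalgebra ℂ B) (hK : IsClosed (K : Set B)) {b : ℕ → B}
    (hb : ∀ n, ∀ x ∈ K, b n * x ∈ K) (hsucc : ∀ n, star (b n) * b n = b (n + 1))
    (hdist : ∀ ε : ℝ, 0 < ε → ∃ c : ℝ, ∀ n, Metric.infDist (b n) K ≤ c * ε ^ 2 ^ n) :
    b 0 ∈ K := by
  refine (hK.mem_iff_infDist_zero ⟨0, K.zero_mem⟩).mpr ?_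
  by_contra hne
  set r := Metric.infDist (b 0) K / 4 with hr
  have hr0 : 0 < r := by
    have := lt_of_le_of_ne Metric.infDist_nonneg (Ne.symm hne)
    positivity
  have hlow : ∀ n, r ^ 2 ^ n ≤ Metric.infDist (b n) K / 4 := by
    intro n
    induction n with
    | zero => simp [hr]
    | succ n ih =>
      have h1 := K.infDist_sq_le hK (hb n)
      rw [hsucc] at h1
      have h2 := pow_le_pow_left₀ (by positivity) ih 2
      rw [pow_succ, pow_mul]
      nlinarith
  obtain ⟨c, hc⟩ := hdist (r / 2) (by positivity)
  obtain ⟨n, hn⟩ := pow_unbounded_of_one_lt c (one_lt_two (α := ℝ))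
  have h1 := (hlow n).trans (div_le_div_of_nonneg_right (hc n) (by norm_num))
  rw [div_pow r 2] at h1
  have hp : 0 < r ^ 2 ^ n := by positivity
  have h2 : (2 : ℝ) ^ n ≤ 2 ^ 2 ^ n := pow_le_pow_right₀ one_le_two n.lt_two_pow_self.le
  have h3 : r ^ 2 ^ n * 2 ^ 2 ^ n ≤ c / 4 * r ^ 2 ^ n := by
    have h4 : (0 : ℝ) < 2 ^ 2 ^ n := by positivity
    have : c * (r ^ 2 ^ n / 2 ^ 2 ^ n) / 4 * 2 ^ 2 ^ n = c / 4 * r ^ 2 ^ n := by field_simp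
    rw [← this]
    gcongr
  have h5 : (2 : ℝ) ^ 2 ^ n ≤ c / 4 := by
    rw [mul_comm] at h3
    exact le_of_mul_le_mul_right h3 hp
  have : 0 < (2 : ℝ) ^ n := by positivity
  linarith

theorem prod_map_sub_algebraMap_mul_of_mul_eq_smul {D : Type*} [Ring D] [Algebra ℂ D] {a p : D}
    {w : ℝ} (h : a * p = (w : ℂ) • p) (l : List ℝ) :
    (l.map fun r : ℝ => a - algebraMap ℂ D r).prod * p =
      ((l.map fun r : ℝ => w - r).prod : ℂ) • p := by
  induction l with
  | nil => simp
  | cons r l ih =>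
    rw [List.map_cons, List.prod_cons, mul_assoc, ih, List.map_cons, List.prod_cons,
      mul_smul_comm, sub_mul, h, ← Algebra.smul_def, ← sub_smul, smul_smul, mul_comm]
    push_cast
    rfl

theorem finiteDimensional_quotient_of_selfAdjoint_algebraic {A : Type*} [NormedRing A]
    [NormedAlgebra ℂ A] [CompleteSpace A] [StarRing A] [StarModule ℂ A]
    [ContinuousStar A] (J : Submodule ℂ A) (hJc : IsClosed (J : Set A))
    (hJ : ∀ a x : A, x ∈ J → a * x ∈ J ∧ x * a ∈ J) (hJs : ∀ x ∈ J, star x ∈ J)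
    (hproper : ∀ x : A, star x * x ∈ J → x ∈ J)
    (halg : ∀ a : A, IsSelfAdjoint a → ∃ Λ : Finset ℝ,
      (Λ.toList.map fun l : ℝ => a - algebraMap ℂ A l).prod ∈ J) :
    FiniteDimensional ℂ (A ⧸ J) := by
  let J' : Ideal A :=
    { carrier := J
      add_mem' := J.add_mem
      zero_mem' := J.zero_mem
      smul_mem' := fun c x hx => (hJ c x hx).1 }
  have htwo : J'.IsTwoSided := ⟨fun b hx => (hJ b _ hx).2⟩
  let π : A →ₐ[ℂ] A ⧸ J' := Ideal.Quotient.mkₐ ℂ J'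
  have hπ : Function.Surjective π := Ideal.Quotient.mkₐ_surjective ℂ J'
  have hπ0 : ∀ x, π x = 0 ↔ x ∈ J := fun x => Ideal.Quotient.eq_zero_iff_mem
  have hπeq : ∀ x y, π x = π y ↔ x - y ∈ J := fun x y => by rw [← hπ0, map_sub, sub_eq_zero]
  let σ : A ⧸ J' → A ⧸ J' := Quotient.lift (fun a => π (star a)) fun a b hab => by
    rw [hπeq, ← star_sub]
    exact hJs _ ((hπeq a b).mp (Quotient.sound hab))
  have hσ : ∀ a, σ (π a) = π (star a) := fun a => rfl
  let _ : StarRing (A ⧸ J') :=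
    { star := σ
      star_involutive := hπ.forall.mpr fun a => by rw [hσ, hσ, star_star]
      star_mul := hπ.forall.mpr fun a => hπ.forall.mpr fun b => by
        change σ _ = σ _ * σ _
        rw [← map_mul, hσ, hσ, hσ, star_mul, map_mul]
      star_add := hπ.forall.mpr fun a => hπ.forall.mpr fun b => by
        change σ _ = σ _ + σ _
        rw [← map_add, hσ, hσ, hσ, star_add, map_add] }
  have hs : ∀ a, star (π a) = π (star a) := hσ
  have : StarModule ℂ (A ⧸ J') := ⟨fun c => hπ.forall.mpr fun a => by
    rw [← map_smul, hs, hs, star_smul, map_smul]⟩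
  have hlift : ∀ d : A ⧸ J', IsSelfAdjoint d → ∃ x, IsSelfAdjoint x ∧ π x = d := by
    refine hπ.forall.mpr fun y hy => ⟨(realPart y : A), (realPart y).2, ?_⟩
    have h1 : π (star y) = π y := by rw [← hs]; exact hy
    rw [realPart_apply_coe, ← Complex.coe_smul, map_smul, map_add, h1, ← two_smul ℂ, smul_smul]
    norm_num
  have hfd : FiniteDimensional ℂ (A ⧸ J') := by
    refine finiteDimensional_of_selfAdjoint_algebraic ?_ ?_ ?_
    · refine hπ.forall.mpr fun x hx => ?_
      rw [hs, ← map_mul, hπ0] at hx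
      exact (hπ0 x).mpr (hproper x hx)
    · intro d hd
      obtain ⟨a, ha, rfl⟩ := hlift d hd
      obtain ⟨Λ, hΛ⟩ := halg a ha
      refine ⟨Λ, ?_⟩
      rw [← (hπ0 _).mpr hΛ, map_list_prod, List.map_map]
      congr 2
    · intro p hp hp0 hpo
      choose x hx hxp using fun n => hlift (p n) (hp n).isSelfAdjoint
      let w : ℕ → ℝ := fun n => (1 / 2) ^ n / (1 + ‖x n‖)
      have hw0 : ∀ n, 0 < w n := fun n => by positivity
      have hw1 : ∀ n, w n ≤ (1 / 2) ^ n := fun n =>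
        div_le_self (by positivity) (by linarith [norm_nonneg (x n)])
      have hsum : Summable fun n => (w n : ℂ) • x n := by
        refine Summable.of_norm_bounded (g := fun n => (1 / 2 : ℝ) ^ n)
          (summable_geometric_of_lt_one (by norm_num) (by norm_num)) fun n => ?_
        rw [norm_smul, Complex.norm_real, Real.norm_of_nonneg (hw0 n).le]
        have : 0 < 1 + ‖x n‖ := by positivity
        rw [div_mul_eq_mul_div, div_le_iff₀ this]
        gcongr
        linarith
      obtain ⟨a, ha⟩ := hsum
      have hasa : IsSelfAdjoint a := by
        refine ha.star.unique ?_
        convert ha using 2 with n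
        simp [star_smul, (hx n).star_eq]
      have hap : ∀ n, π a * p n = (w n : ℂ) • p n := by
        intro n
        rw [← hxp, ← map_mul, ← map_smul, hπeq]
        have ht : Tendsto (fun s : Finset ℕ => (∑ m ∈ s, (w m : ℂ) • x m) * x n - (w n : ℂ) • x n)
            atTop (𝓝 (a * x n - (w n : ℂ) • x n)) :=
          (Tendsto.mul_const (x n) ha).sub_const _
        refine hJc.mem_of_tendsto ht ?_
        filter_upwards [eventually_ge_atTop {n}] with s hs
        rw [SetLike.mem_coe, ← hπeq, map_mul, map_smul, map_sum, Finset.sum_mul, hxp]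
        rw [Finset.sum_eq_single n]
        · rw [map_smul, hxp, smul_mul_assoc, (hp n).isIdempotentElem]
        · intro m _ hmn
          rw [map_smul, hxp, smul_mul_assoc, hpo m n hmn, smul_zero]
        · exact fun h => absurd (hs (Finset.mem_singleton_self n)) h
      obtain ⟨Λ, hΛ⟩ := halg a hasa
      have hwΛ : ∀ n, w n ∈ Λ := by
        intro n
        have h1 := prod_map_sub_algebraMap_mul_of_mul_eq_smul (hap n) Λ.toList
        have h2 : (Λ.toList.map fun r : ℝ => π a - algebraMap ℂ (A ⧸ J') r).prod = 0 := by
          rw [← (hπ0 _).mpr hΛ, map_list_prod, List.map_map]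
          congr 2
        rw [h2, zero_mul, eq_comm, smul_eq_zero, or_iff_left (hp0 n), Complex.ofReal_eq_zero,
          List.prod_eq_zero_iff] at h1
        simpa [sub_eq_zero] using h1
      have hwlim : Tendsto w atTop (𝓝 0) := squeeze_zero (fun n => (hw0 n).le) hw1
        (tendsto_pow_atTop_nhds_zero_of_lt_one (by norm_num) (by norm_num))
      have hnhds : ((Λ.erase 0 : Finset ℝ) : Set ℝ)ᶜ ∈ 𝓝 (0 : ℝ) :=
        (Λ.erase 0).finite_toSet.isClosed.isOpen_compl.mem_nhds (by simp)
      obtain ⟨n, hn⟩ := (hwlim.eventually hnhds).exists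
      exact hn (Finset.mem_coe.mpr (Finset.mem_erase.mpr ⟨(hw0 n).ne', hwΛ n⟩))
  have hker : J ≤ LinearMap.ker π.toLinearMap := fun x hx => (hπ0 x).mpr hx
  refine FiniteDimensional.of_injective (J.liftQ π.toLinearMap hker) ?_
  refine LinearMap.ker_eq_bot.mp (Submodule.ker_liftQ_eq_bot _ _ _ fun x hx => ?_)
  exact (hπ0 x).mp hx

theorem spectralRadius_le_of_norm_pow_le {A B : Type*} [NormedRing A] [NormedAlgebra ℂ A]
    [CompleteSpace A] [NonUnitalNormedRing B] [Module ℂ B] (ι : A →ₙₐ[ℂ] B)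
    {k : ℕ} {p q C : ℝ} (hk : 2 ≤ k) (hp : 0 < p) (hq : 0 < q) (hpq : p + q = (k : ℝ))
    (hC : 0 < C) (hdiff : ∀ a : A, ‖a ^ k‖ ≤ C * ‖a‖ ^ p * ‖ι a‖ ^ q) (y : A) :
    spectralRadius ℂ y ≤ ENNReal.ofReal ‖ι y‖ := by
  have hfin : spectralRadius ℂ y ≠ ⊤ := by
    refine ne_top_of_le_ne_top ?_ (spectrum.spectralRadius_le_pow_nnnorm_pow_one_div ℂ y 0)
    simp [ENNReal.mul_eq_top]
  set r := (spectralRadius ℂ y).toReal with hr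
  have hr0 : 0 ≤ r := ENNReal.toReal_nonneg
  rw [← ENNReal.ofReal_toReal hfin, ← hr]
  refine ENNReal.ofReal_le_ofReal ?_
  have hlim : Tendsto (fun n : ℕ => ‖y ^ n‖ ^ (1 / n : ℝ)) atTop (𝓝 r) := by
    have h := (ENNReal.tendsto_toReal hfin).comp
      (spectrum.pow_nnnorm_pow_one_div_tendsto_nhds_spectralRadius y)
    refine h.congr fun n => ?_
    simp [← ENNReal.toReal_rpow]
  have hmul : Tendsto (fun n : ℕ => n * k) atTop atTop :=
    tendsto_id.atTop_mul_const' (by omega)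
  have h1 : Tendsto (fun n : ℕ => ‖y ^ (n * k)‖ ^ (1 / n : ℝ)) atTop (𝓝 (r ^ k)) := by
    refine ((hlim.comp hmul).pow k).congr fun n => ?_
    have hk0 : (k : ℝ) ≠ 0 := by positivity
    simp only [Function.comp]
    rw [← Real.rpow_natCast, ← Real.rpow_mul (norm_nonneg _)]
    congr 1
    push_cast
    field_simp
  have h2 : Tendsto (fun n : ℕ => C ^ (1 / n : ℝ) * (‖y ^ n‖ ^ (1 / n : ℝ)) ^ p * ‖ι y‖ ^ q)
      atTop (𝓝 (1 * r ^ p * ‖ι y‖ ^ q)) := by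
    refine (Tendsto.mul ?_ (hlim.rpow_const (Or.inr hp.le))).mul_const _
    have := (tendsto_const_nhds (x := C)).rpow tendsto_one_div_atTop_nhds_zero_nat (Or.inl hC.ne')
    simpa using this
  have hpow : ∀ n : ℕ, 0 < n → ‖ι (y ^ n)‖ ≤ ‖ι y‖ ^ n := by
    intro n hn
    induction n, hn using Nat.le_induction with
    | base => simp
    | succ n hn ih =>
      rw [pow_succ, map_mul, pow_succ]
      exact (norm_mul_le _ _).trans (by gcongr)
  have h3 : r ^ k ≤ r ^ p * ‖ι y‖ ^ q := by
    rw [← one_mul (r ^ p)]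
    refine le_of_tendsto_of_tendsto h1 h2 ?_
    filter_upwards [eventually_gt_atTop 0] with n hn
    have hn0 : (n : ℝ) ≠ 0 := by positivity
    calc ‖y ^ (n * k)‖ ^ (1 / n : ℝ) ≤ (C * ‖y ^ n‖ ^ p * (‖ι y‖ ^ n) ^ q) ^ (1 / n : ℝ) := by
          rw [pow_mul]
          gcongr
          refine (hdiff _).trans ?_
          gcongr
          exact hpow n hn
      _ = C ^ (1 / n : ℝ) * (‖y ^ n‖ ^ (1 / n : ℝ)) ^ p * ‖ι y‖ ^ q := by
          rw [Real.mul_rpow (by positivity) (by positivity), Real.mul_rpow hC.le (by positivity),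
            ← Real.rpow_natCast ‖ι y‖ n, ← Real.rpow_mul (by positivity),
            ← Real.rpow_mul (by positivity), ← Real.rpow_mul (by positivity),
            ← Real.rpow_mul (by positivity)]
          congr 2
          · rw [mul_comm]
          · field_simp
  by_contra hlt
  push Not at hlt
  have hrpos : 0 < r := (norm_nonneg _).trans_lt hlt
  have h4 : r ^ k = r ^ p * r ^ q := by rw [← Real.rpow_natCast, ← hpq, Real.rpow_add hrpos]
  rw [h4] at h3
  have h5 := le_of_mul_le_mul_left h3 (by positivity)
  exact absurd (Real.rpow_lt_rpow (norm_nonneg _) hlt hq) (not_lt.mpr h5)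

theorem exists_dist_pow_le_of_map_mem_closure {A B : Type*} [NormedRing A] [NormedAlgebra ℂ A]
    [CompleteSpace A] [NonUnitalNormedRing B] [Module ℂ B] (ι : A →ₙₐ[ℂ] B)
    {k : ℕ} {p q C : ℝ} (hk : 2 ≤ k) (hp : 0 < p) (hq : 0 < q) (hpq : p + q = (k : ℝ))
    (hC : 0 < C) (hdiff : ∀ a : A, ‖a ^ k‖ ≤ C * ‖a‖ ^ p * ‖ι a‖ ^ q)
    (I : Submodule ℂ A) (hI : ∀ a x : A, x ∈ I → a * x ∈ I ∧ x * a ∈ I) {a : A}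
    (ha : ι a ∈ closure (ι '' I)) {ε : ℝ} (hε : 0 < ε) :
    ∃ K : ℝ, ∀ m : ℕ, ∃ x ∈ I, ‖a ^ m - x‖ ≤ K * ε ^ m := by
  obtain ⟨_, ⟨x, hx, rfl⟩, hax⟩ := Metric.mem_closure_iff.mp ha ε hε
  rw [dist_eq_norm, ← map_sub] at hax
  obtain ⟨K, hK⟩ := exists_norm_pow_le_of_spectralRadius_lt hε
    ((spectralRadius_le_of_norm_pow_le ι hk hp hq hpq hC hdiff (a - x)).trans_lt
      ((ENNReal.ofReal_lt_ofReal_iff hε).mpr hax))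
  refine ⟨K, fun m => ⟨a ^ m - (a - x) ^ m, ?_, by rw [sub_sub_cancel]; exact hK m⟩⟩
  induction m with
  | zero => simp
  | succ m ih =>
    have : a ^ (m + 1) - (a - x) ^ (m + 1) = (a ^ m - (a - x) ^ m) * a + (a - x) ^ m * x := by
      rw [pow_succ, pow_succ]; noncomm_ring
    rw [this]
    exact I.add_mem (hI _ _ ih).2 (hI _ _ hx).1

theorem Complex.rpow_mul_cos_le_re_cpow {γ : ℝ} (hγ0 : 0 < γ) (hγ : γ < 1) {w : ℂ}
    (hw : 0 ≤ w.re) : ‖w‖ ^ γ * Real.cos (Real.pi * γ / 2) ≤ (w ^ (γ : ℂ)).re := by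
  rcases eq_or_ne w 0 with rfl | hw0
  · simp [hγ0.ne']
  have harg : |w.arg| ≤ Real.pi / 2 := Complex.abs_arg_le_pi_div_two_iff.mpr hw
  have hn : 0 < ‖w‖ := norm_pos_iff.mpr hw0
  have h1 : (w ^ (γ : ℂ)).re = ‖w‖ ^ γ * Real.cos (w.arg * γ) := by
    rw [Complex.cpow_def_of_ne_zero hw0, Complex.exp_re, Complex.re_mul_ofReal,
      Complex.im_mul_ofReal, Complex.log_re, Complex.log_im, Real.rpow_def_of_pos hn]
  rw [h1, ← Real.cos_abs (w.arg * γ), abs_mul, abs_of_pos hγ0]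
  gcongr
  refine Real.cos_le_cos_of_nonneg_of_le_pi (by positivity) ?_ ?_
  · nlinarith [Real.pi_pos]
  · nlinarith

theorem norm_le_of_imaginary_growth_of_type_zero {G : ℂ → ℂ} (hG : Differentiable ℂ G)
    {γ D M : ℝ} (hγ0 : 0 < γ) (hγ : γ < 1) (hD : 0 ≤ D)
    (him : ∀ t : ℝ, ‖G (Complex.I * t)‖ ≤ M * Real.exp (D * (1 + |t| ^ γ)))
    (htype : ∀ ε : ℝ, 0 < ε → ∃ K : ℝ, ∀ w, ‖G w‖ ≤ K * Real.exp (ε * ‖w‖)) {s : ℝ}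
    (hs : 0 ≤ s) :
    ‖G s‖ ≤ M * Real.exp (D / Real.cos (Real.pi * γ / 2) * (1 + s ^ γ)) := by
  set κ := Real.cos (Real.pi * γ / 2) with hκ
  have hκ0 : 0 < κ := by
    refine Real.cos_pos_of_mem_Ioo ⟨?_, ?_⟩ <;> nlinarith [Real.pi_pos, mul_pos Real.pi_pos hγ0]
  have hκ1 : κ ≤ 1 := Real.cos_le_one _
  set c := D / κ with hc
  have hc0 : 0 ≤ c := by positivity
  have hDc : D ≤ c := le_div_self hD hκ0 hκ1
  have hM : 0 ≤ M := by
    have := (norm_nonneg _).trans (him 0)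
    exact nonneg_of_mul_nonneg_left this (Real.exp_pos _)
  have key : ∀ ε : ℝ, 0 < ε →
      ‖G s‖ * Real.exp (-(c * s ^ γ) - ε * s) ≤ M * Real.exp D := by
    intro ε hε
    let f : ℂ → ℂ := fun w => G w * Complex.exp (-(c * w ^ (γ : ℂ)) - ε * w)
    have hfn : ∀ w, ‖f w‖ = ‖G w‖ * Real.exp (-(c * (w ^ (γ : ℂ)).re) - ε * w.re) := by
      intro w
      simp [f, Complex.norm_exp]
    have hfle : ∀ w : ℂ, 0 ≤ w.re → ‖f w‖ ≤ ‖G w‖ * Real.exp (-(ε * w.re)) := by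
      intro w hw
      rw [hfn]
      gcongr
      have := Complex.rpow_mul_cos_le_re_cpow hγ0 hγ hw
      have : 0 ≤ (w ^ (γ : ℂ)).re := le_trans (by positivity) this
      have := mul_nonneg hc0 this
      linarith
    have hd : DiffContOnCl ℂ f {z | 0 < z.re} := by
      refine ⟨fun z hz => ?_, fun z hz => ?_⟩
      · have : z ∈ Complex.slitPlane := Or.inl hz
        refine DifferentiableAt.differentiableWithinAt ?_
        refine (hG z).mul (DifferentiableAt.cexp ?_)
        refine DifferentiableAt.sub ((DifferentiableAt.const_mul ?_ _).neg)
          (differentiableAt_id.const_mul _)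
        exact differentiableAt_id.cpow_const this
      · rw [Complex.closure_setOfPred_lt_re] at hz
        refine ContinuousAt.continuousWithinAt ?_
        refine (hG z).continuousAt.mul (ContinuousAt.cexp ?_)
        refine ContinuousAt.sub (ContinuousAt.neg (continuousAt_const.mul ?_))
          (continuousAt_const.mul continuousAt_id)
        exact Complex.continuousAt_cpow_const_of_re_pos (Or.inl hz) (by simpa using hγ0)
    have hexp : ∃ c < (2 : ℝ), ∃ B, f =O[Bornology.cobounded ℂ ⊓ 𝓟 {z | 0 < z.re}]
        fun z => Real.exp (B * ‖z‖ ^ c) := by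
      obtain ⟨K, hK⟩ := htype 1 one_pos
      refine ⟨1, by norm_num, 1, Asymptotics.IsBigO.of_bound K ?_⟩
      refine Filter.Eventually.filter_mono inf_le_right (eventually_principal.mpr fun z hz => ?_)
      have hz : 0 < z.re := hz
      rw [Real.rpow_one, Real.norm_of_nonneg (Real.exp_pos _).le]
      refine (hfle z hz.le).trans (le_trans ?_ (hK z))
      refine mul_le_of_le_one_right (norm_nonneg _) (Real.exp_le_one_iff.mpr ?_)
      have := mul_pos hε hz
      linarith
    have hre : Tendsto (fun x : ℝ => f x) atTop (𝓝 0) := by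
      obtain ⟨K, hK⟩ := htype (ε / 2) (by positivity)
      have h0 : Tendsto (fun x : ℝ => K * Real.exp (-(ε / 2 * x))) atTop (𝓝 (K * 0)) := by
        refine Tendsto.const_mul _ (Real.tendsto_exp_neg_atTop_nhds_zero.comp ?_)
        exact tendsto_id.const_mul_atTop (by positivity)
      rw [mul_zero] at h0
      refine squeeze_zero_norm' ?_ h0
      filter_upwards [eventually_ge_atTop 0] with x hx
      refine (hfle x (by simpa using hx)).trans ?_
      have := hK x
      rw [Complex.norm_real, Real.norm_of_nonneg hx] at this
      refine (mul_le_mul_of_nonneg_right this (Real.exp_pos _).le).trans_eq ?_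
      rw [mul_assoc, ← Real.exp_add, Complex.ofReal_re]
      ring_nf
    have himf : ∀ x : ℝ, ‖f (x * Complex.I)‖ ≤ M * Real.exp D := by
      intro x
      have h1 := Complex.rpow_mul_cos_le_re_cpow hγ0 hγ (w := x * Complex.I) (by simp)
      rw [norm_mul, Complex.norm_I, mul_one, Complex.norm_real, Real.norm_eq_abs] at h1
      have h2 : D * |x| ^ γ ≤ c * ((x * Complex.I) ^ (γ : ℂ)).re := by
        refine le_trans (le_of_eq ?_) (mul_le_mul_of_nonneg_left h1 hc0)
        rw [← hκ, hc]
        field_simp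
      rw [hfn, mul_comm (x : ℂ)]
      refine (mul_le_mul_of_nonneg_right (him x) (Real.exp_pos _).le).trans ?_
      rw [mul_assoc, ← Real.exp_add]
      rw [mul_comm (x : ℂ)] at h2
      gcongr
      simp
      linarith
    have := PhragmenLindelof.right_half_plane_of_tendsto_zero_on_real hd hexp hre himf
      (z := (s : ℂ)) (by simpa using hs)
    rw [hfn, ← Complex.ofReal_cpow hs] at this
    simpa using this
  have hlim : Tendsto (fun ε : ℝ => ‖G s‖ * Real.exp (-(c * s ^ γ) - ε * s)) (𝓝[>] 0)
      (𝓝 (‖G s‖ * Real.exp (-(c * s ^ γ) - 0 * s))) := by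
    refine Tendsto.mono_left (Continuous.tendsto ?_ 0) nhdsWithin_le_nhds
    fun_prop
  have h1 := le_of_tendsto hlim (eventually_mem_nhdsWithin.mono fun ε hε => key ε hε)
  rw [zero_mul, sub_zero, Real.exp_neg, ← div_eq_mul_inv, div_le_iff₀ (Real.exp_pos _), mul_assoc,
    ← Real.exp_add] at h1
  refine h1.trans ?_
  gcongr
  linarith

theorem norm_exp_neg_smul_exp_mul_sub_le {A : Type*} [NormedRing A] [NormedAlgebra ℂ A]
    [CompleteSpace A] (T x : A) {N s : ℝ} (hT : ‖T‖ ≤ N) (hs : 0 ≤ s) :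
    ‖Complex.exp (-s) • (NormedSpace.exp ((s : ℂ) • T) * x) - x‖ ≤
      (1 + ‖(1 : A)‖) * Real.exp (s * N) * s * ‖T * x - x‖ := by
  let v : ℝ → A := fun r => Complex.exp (-r) • (NormedSpace.exp ((r : ℂ) • T) * x)
  have hv : ∀ r : ℝ, HasDerivAt v
      (Complex.exp (-r) • (NormedSpace.exp ((r : ℂ) • T) * (T * x - x))) r := by
    intro r
    have h1 : HasDerivAt (fun z : ℂ => Complex.exp (-z) • (NormedSpace.exp (z • T) * x))
        (Complex.exp (-r) • (NormedSpace.exp ((r : ℂ) • T) * T * x) +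
          (Complex.exp (-r) * -1) • (NormedSpace.exp ((r : ℂ) • T) * x)) (r : ℂ) :=
      ((hasDerivAt_neg (r : ℂ)).cexp).fun_smul ((hasDerivAt_exp_smul_const T (r : ℂ)).mul_const x)
    refine (h1.scomp r Complex.ofRealCLM.hasDerivAt).congr_deriv ?_
    rw [Complex.ofRealCLM_apply, Complex.ofReal_one, one_smul, mul_sub, smul_sub, mul_neg_one, neg_smul, mul_assoc, sub_eq_add_neg]
  have hbound := norm_image_sub_le_of_norm_deriv_le_segment'
    (f := v) (a := 0) (b := s) (C := (1 + ‖(1 : A)‖) * Real.exp (s * N) * ‖T * x - x‖)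
    (fun r _ => (hv r).hasDerivWithinAt) (fun r hr => ?_) s (Set.right_mem_Icc.mpr hs)
  · have hv0 : v 0 = x := by simp [v]
    rw [hv0, sub_zero] at hbound
    refine hbound.trans_eq ?_
    ring
  · have hr0 : 0 ≤ r := hr.1
    have hN : 0 ≤ N := (norm_nonneg _).trans hT
    have h1 : ‖Complex.exp (-r)‖ ≤ 1 := by
      rw [Complex.norm_exp]
      simpa using hr0
    have h2 : ‖NormedSpace.exp ((r : ℂ) • T)‖ ≤ (1 + ‖(1 : A)‖) * Real.exp (s * N) := by
      refine (norm_normedSpace_exp_le _).trans ?_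
      rw [norm_smul, Complex.norm_real, Real.norm_of_nonneg hr0]
      gcongr
      exact hr.2.le
    rw [norm_smul]
    refine (mul_le_of_le_one_left (norm_nonneg _) h1).trans ((norm_mul_le _ _).trans ?_)
    gcongr

theorem Submodule.exists_dual_eq_zero_of_notMem {E : Type*} [NormedAddCommGroup E]
    [NormedSpace ℂ E] (I : Submodule ℂ E) (hI : IsClosed (I : Set E)) {x : E} (hx : x ∉ I) :
    ∃ φ : E →L[ℂ] ℂ, (∀ y ∈ I, φ y = 0) ∧ φ x ≠ 0 := by
  have := hI
  have hne : I.mkQ x ≠ 0 := by simpa using hx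
  obtain ⟨g, -, hg⟩ := exists_dual_vector ℂ (I.mkQ x) (norm_ne_zero_iff.mpr hne)
  refine ⟨g.comp I.mkQL, fun y hy => ?_, ?_⟩
  · have : I.mkQL y = 0 := by simpa using hy
    simp [this]
  · change g (I.mkQ x) ≠ 0
    rw [hg]
    exact RCLike.ofReal_ne_zero.mpr (norm_ne_zero_iff.mpr hne)

theorem norm_dual_exp_smul_mul_le {A : Type*} [NormedRing A] [NormedAlgebra ℂ A]
    [CompleteSpace A] (I : Submodule ℂ A) (hI : ∀ a x : A, x ∈ I → x * a ∈ I)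
    (φ : A →L[ℂ] ℂ) (hφ : ∀ y ∈ I, φ y = 0) {T x : A} {K ε : ℝ}
    (hT : ∀ m : ℕ, ∃ y ∈ I, ‖T ^ m - y‖ ≤ K * ε ^ m) (w : ℂ) :
    ‖φ (NormedSpace.exp (w • T) * x)‖ ≤ ‖φ‖ * K * ‖x‖ * Real.exp (ε * ‖w‖) := by
  have h := NormedSpace.exp_series_hasSum_exp' (𝕂 := ℂ) (w • T)
  have h1 := (h.mul_right x).mapL φ
  have hr : HasSum (fun n : ℕ => ‖φ‖ * K * ‖x‖ * ((ε * ‖w‖) ^ n / (n.factorial : ℝ)))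
      (‖φ‖ * K * ‖x‖ * Real.exp (ε * ‖w‖)) := by
    refine HasSum.mul_left _ ?_
    have := NormedSpace.exp_series_hasSum_exp' (𝕂 := ℝ) (ε * ‖w‖)
    rw [← Real.exp_eq_exp_ℝ] at this
    simpa [div_eq_inv_mul] using this
  rw [← h1.tsum_eq]
  refine tsum_of_norm_bounded hr fun n => ?_
  obtain ⟨y, hy, hyn⟩ := hT n
  have h2 : φ (T ^ n * x) = φ ((T ^ n - y) * x) := by
    rw [sub_mul, map_sub, hφ _ (hI _ _ hy), sub_zero]
  have h3 : ‖φ (T ^ n * x)‖ ≤ ‖φ‖ * (K * ε ^ n * ‖x‖) := by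
    rw [h2]
    refine (φ.le_opNorm _).trans ?_
    gcongr
    refine (norm_mul_le _ _).trans ?_
    gcongr
  rw [smul_mul_assoc, map_smul, smul_pow, smul_mul_assoc, map_smul, norm_smul, norm_smul,
    norm_inv, Complex.norm_natCast, norm_pow]
  calc ((n.factorial : ℝ))⁻¹ * (‖w‖ ^ n * ‖φ (T ^ n * x)‖)
      ≤ ((n.factorial : ℝ))⁻¹ * (‖w‖ ^ n * (‖φ‖ * (K * ε ^ n * ‖x‖))) := by gcongr
    _ = ‖φ‖ * K * ‖x‖ * ((ε * ‖w‖) ^ n / (n.factorial : ℝ)) := by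
      rw [mul_pow]; ring

theorem Submodule.mem_of_tendsto_mul_of_exp_growth {A J : Type*} [NormedRing A] [NormedAlgebra ℂ A]
    [CompleteSpace A] (I : Submodule ℂ A) (hIc : IsClosed (I : Set A))
    (hI : ∀ a x : A, x ∈ I → x * a ∈ I) {γ D N : ℝ} (hγ0 : 0 < γ) (hγ : γ < 1) (hD : 0 ≤ D)
    {F : Filter J} [F.NeBot] {T : J → A} (hTN : ∀ j, ‖T j‖ ≤ N)
    (hg : ∀ j, ∀ t : ℝ,
      ‖NormedSpace.exp ((Complex.I * t) • T j)‖ ≤ Real.exp (D * (1 + |t| ^ γ)))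
    (hT : ∀ j, ∀ ε : ℝ, 0 < ε → ∃ K : ℝ, ∀ m : ℕ, ∃ y ∈ I, ‖T j ^ m - y‖ ≤ K * ε ^ m)
    {x : A} (hx : Tendsto (fun j => T j * x) F (𝓝 x)) : x ∈ I := by
  by_contra hxI
  obtain ⟨φ, hφ, hφx⟩ := I.exists_dual_eq_zero_of_notMem hIc hxI
  set c := D / Real.cos (Real.pi * γ / 2)
  set M := ‖φ‖ * ‖x‖
  have hG : ∀ j, ∀ s : ℝ, 0 ≤ s →
      ‖φ (NormedSpace.exp ((s : ℂ) • T j) * x)‖ ≤ M * Real.exp (c * (1 + s ^ γ)) := by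
    intro j s hs
    refine norm_le_of_imaginary_growth_of_type_zero
      (G := fun w => φ (NormedSpace.exp (w • T j) * x)) ?_ hγ0 hγ hD ?_ ?_ hs
    · intro w
      exact φ.differentiableAt.comp w
        ((hasDerivAt_exp_smul_const (T j) w).mul_const x).differentiableAt
    · intro t
      calc ‖φ (NormedSpace.exp ((Complex.I * t) • T j) * x)‖
          ≤ ‖φ‖ * (Real.exp (D * (1 + |t| ^ γ)) * ‖x‖) := by
            refine (φ.le_opNorm _).trans ?_
            gcongr
            refine (norm_mul_le _ _).trans ?_
            gcongr
            exact hg j t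
        _ = M * Real.exp (D * (1 + |t| ^ γ)) := by ring
    · intro ε hε
      obtain ⟨K, hK⟩ := hT j ε hε
      exact ⟨_, norm_dual_exp_smul_mul_le I hI φ hφ hK⟩
  have hlim : ∀ s : ℝ, 0 ≤ s → Real.exp s * ‖φ x‖ ≤ M * Real.exp (c * (1 + s ^ γ)) := by
    intro s hs
    have h1 : Tendsto (fun j => Complex.exp (-s) • (NormedSpace.exp ((s : ℂ) • T j) * x)) F
        (𝓝 x) := by
      rw [tendsto_iff_norm_sub_tendsto_zero] at hx ⊢
      refine squeeze_zero (fun _ => norm_nonneg _)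
        (fun j => norm_exp_neg_smul_exp_mul_sub_le (T j) x (hTN j) hs) ?_
      simpa using hx.const_mul ((1 + ‖(1 : A)‖) * Real.exp (s * N) * s)
    have h2 := ((φ.continuous.tendsto x).comp h1).norm
    have h3 : ‖φ x‖ ≤ Real.exp (-s) * (M * Real.exp (c * (1 + s ^ γ))) := by
      refine le_of_tendsto h2 (Eventually.of_forall fun j => ?_)
      simp only [Function.comp, map_smul, norm_smul]
      rw [Complex.norm_exp]
      simp only [Complex.neg_re, Complex.ofReal_re]
      gcongr
      exact hG j s hs
    rw [Real.exp_neg, inv_mul_eq_div, le_div_iff₀ (Real.exp_pos _)] at h3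
    linarith
  have hφ0 : 0 < ‖φ x‖ := norm_pos_iff.mpr hφx
  obtain ⟨s, hs, hlt⟩ := exp_rpow_growth_lt_exp (γ := γ) (β := 1) (K := M / ‖φ x‖) (D := c)
    hγ0 hγ one_pos
  have h1 := hlim s hs.le
  rw [one_mul, div_mul_eq_mul_div, div_lt_iff₀ hφ0] at hlt
  linarith

theorem IsSelfAdjoint.prod_map_sub_algebraMap {A : Type*} [Ring A] [StarRing A] [Algebra ℂ A]
    [StarModule ℂ A] {a : A} (ha : IsSelfAdjoint a) (l : List ℝ) :
    IsSelfAdjoint (l.map fun r : ℝ => a - algebraMap ℂ A r).prod := by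
  have hfac : ∀ r : ℝ, IsSelfAdjoint (a - algebraMap ℂ A r) := fun r =>
    ha.sub (IsSelfAdjoint.algebraMap A (Complex.conj_ofReal r))
  induction l with
  | nil => simp
  | cons r l ih =>
    rw [List.map_cons, List.prod_cons, ← (hfac r).commute_iff ih]
    refine Commute.list_prod_right _ _ fun y hy => ?_
    obtain ⟨s, -, rfl⟩ := List.mem_map.mp hy
    exact ((Commute.refl a).sub_left (Algebra.commute_algebraMap_left _ _)).sub_right
      (Algebra.commute_algebraMap_right _ _)

theorem finiteDimensional_quotient_of_orthogonal_sq_mem.{u} {A : Type u} {B : Type*}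
    [NormedRing A] [StarRing A] [NormedAlgebra ℂ A] [StarModule ℂ A] [ContinuousStar A]
    [CompleteSpace A] [NonUnitalCStarAlgebra B] (ι : A →⋆ₙₐ[ℂ] B) (hcont : Continuous ι)
    {k : ℕ} (hk : 2 ≤ k) {p q : ℝ} (hp : 0 < p) (hq : 0 < q) (hpq : p + q = (k : ℝ))
    {C : ℝ} (hC : 0 < C) (hdiff : ∀ a : A, ‖a ^ k‖ ≤ C * ‖a‖ ^ p * ‖ι a‖ ^ q)
    (hblai : ∀ I : Submodule ℂ A, IsClosed (I : Set A) →
      (∀ (a x : A), x ∈ I → a * x ∈ I ∧ x * a ∈ I) →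
      (∀ x ∈ I, star x ∈ I) →
      FiniteDimensional ℂ (A ⧸ I) →
      ∃ (J : Type u) (F : Filter J) (e : J → A), F.NeBot ∧ (∀ j, e j ∈ I) ∧
        (∃ M : ℝ, ∀ j, ‖e j‖ ≤ M) ∧
        ∀ x ∈ I, Tendsto (fun j => e j * x) F (𝓝 x))
    (I : Submodule ℂ A) (hIc : IsClosed (I : Set A))
    (hI : ∀ a x : A, x ∈ I → a * x ∈ I ∧ x * a ∈ I) (hIs : ∀ x ∈ I, star x ∈ I)
    (horth : ∀ g : ℕ → A, (∀ m n, m ≠ n → g m * g n = 0) → ∃ n, g n * g n ∈ I) :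
    FiniteDimensional ℂ (A ⧸ I) := by
  obtain ⟨γ, hγ0, hγ, hgrowth⟩ := exists_exp_growth_bound ι hk hp hq hpq hdiff
  let ιL : A →L[ℂ] B := ⟨(ι : A →ₗ[ℂ] B), hcont⟩
  have hιL : ∀ a, ‖ι a‖ ≤ ‖ιL‖ * ‖a‖ := ιL.le_opNorm
  let S : NonUnitalStarSubalgebra ℂ A :=
    { I with
      mul_mem' := fun {a b} _ hb => (hI a b hb).1
      star_mem' := fun {a} ha => hIs a ha }
  let K : NonUnitalStarSubalgebra ℂ B := (S.map ι).topologicalClosure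
  have hK : IsClosed (K : Set B) := isClosed_closure
  have hIK : ∀ x ∈ I, ι x ∈ K := fun x hx => subset_closure ⟨x, hx, rfl⟩
  have hKl : ∀ a : A, ∀ y ∈ K, ι a * y ∈ K := by
    intro a y hy
    refine map_mem_closure (continuous_const_mul (ι a)) hy ?_
    rintro _ ⟨x, hx, rfl⟩
    exact ⟨a * x, (hI a x hx).1, map_mul ι a x⟩
  have hKr : ∀ a : A, ∀ y ∈ K, y * ι a ∈ K := by
    intro a y hy
    refine map_mem_closure (f := (· * ι a)) (continuous_mul_const (ι a)) hy ?_
    rintro _ ⟨x, hx, rfl⟩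
    exact ⟨x * a, (hI a x hx).2, map_mul ι x a⟩
  let J : Submodule ℂ A :=
    { carrier := {a | ι a ∈ K}
      add_mem' := fun {a b} ha hb => by
        change ι (a + b) ∈ K
        rw [map_add]
        exact add_mem ha hb
      zero_mem' := by
        change ι 0 ∈ K
        rw [map_zero]
        exact zero_mem K
      smul_mem' := fun c a ha => by
        change ι (c • a) ∈ K
        rw [map_smul]
        exact SMulMemClass.smul_mem c ha }
  have hJmem : ∀ a, a ∈ J ↔ ι a ∈ K := fun _ => Iff.rfl
  have hJc : IsClosed (J : Set A) := hK.preimage hcont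
  have hJ : ∀ a x : A, x ∈ J → a * x ∈ J ∧ x * a ∈ J := by
    intro a x hx
    rw [hJmem, hJmem, map_mul, map_mul]
    exact ⟨hKl a _ hx, hKr a _ hx⟩
  have hJs : ∀ x ∈ J, star x ∈ J := by
    intro x hx
    rw [hJmem, map_star]
    exact star_mem hx
  have hfd : FiniteDimensional ℂ (A ⧸ J) := by
    refine finiteDimensional_quotient_of_selfAdjoint_algebraic J hJc hJ hJs ?_ ?_
    · intro x hx
      rw [hJmem, map_mul, map_star] at hx
      exact K.mem_of_star_mul_self_mem hK (hKl x) hx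
    · intro a ha
      obtain ⟨D, hD, hg⟩ := hgrowth ‖a‖
      obtain ⟨Λ, hΛ⟩ := exists_real_polynomial_quasinilpotent_mod I hIc (fun a x hx => (hI a x hx).1)
        hγ0 hγ hD (hg a ha le_rfl) horth
      refine ⟨Λ, ?_⟩
      have hsa := ha.prod_map_sub_algebraMap Λ.toList
      set h := (Λ.toList.map fun l : ℝ => a - algebraMap ℂ A l).prod
      have h0 := K.mem_of_infDist_star_mul_self_iterate_le hK (b := fun n => ι (h ^ 2 ^ n))
        (fun n => hKl _) (fun n => ?_) (fun ε hε => ?_)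
      · rw [hJmem]
        simpa using h0
      · rw [← map_star, ← map_mul, (hsa.pow _).star_eq, ← pow_add, pow_succ, mul_two]
      · obtain ⟨c, hc⟩ := hΛ ε hε
        refine ⟨‖ιL‖ * c, fun n => ?_⟩
        obtain ⟨x, hx, hxn⟩ := hc (2 ^ n)
        refine (Metric.infDist_le_dist_of_mem (hIK x hx)).trans ?_
        rw [dist_eq_norm, ← map_sub, mul_assoc]
        exact (hιL _).trans (by gcongr)
  have hJI : J = I := by
    refine le_antisymm (fun x hx => ?_) hIK
    obtain ⟨ω, F, e, hF, he, ⟨M, hM⟩, hlim⟩ := hblai J hJc hJ hJs hfd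
    let σ : A →L⋆[ℂ] A := (starL ℂ : A ≃L⋆[ℂ] A)
    have hσ : ∀ a, ‖star a‖ ≤ ‖σ‖ * ‖a‖ := σ.le_opNorm
    have hse : ∀ j, ‖star (e j)‖ ≤ ‖σ‖ * M := fun j =>
      (hσ _).trans (by gcongr; exact hM j)
    let T : ω → A := fun j => e j + star (e j) - star (e j) * e j
    have hTs : ∀ j, IsSelfAdjoint (T j) := by
      intro j
      simp only [T, IsSelfAdjoint, star_sub, star_add, star_mul, star_star, add_comm]
    have hTJ : ∀ j, T j ∈ J := fun j =>
      J.sub_mem (J.add_mem (he j) (hJs _ (he j))) (hJ _ _ (he j)).1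
    have hTN : ∀ j, ‖T j‖ ≤ M + ‖σ‖ * M + ‖σ‖ * M * M := by
      intro j
      have hs0 : 0 ≤ ‖σ‖ * M := (norm_nonneg _).trans (hse j)
      refine (norm_sub_le _ _).trans (add_le_add ((norm_add_le _ _).trans
        (add_le_add (hM j) (hse j))) ((norm_mul_le _ _).trans ?_))
      exact mul_le_mul (hse j) (hM j) (norm_nonneg _) hs0
    have hTx : Tendsto (fun j => T j * x) F (𝓝 x) := by
      have h1 := hlim x hx
      rw [tendsto_iff_norm_sub_tendsto_zero] at h1 ⊢
      have h2 : Tendsto (fun j => (‖(1 : A)‖ + ‖σ‖ * M) * ‖e j * x - x‖) F (𝓝 0) := by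
        simpa using h1.const_mul (‖(1 : A)‖ + ‖σ‖ * M)
      refine squeeze_zero (fun _ => norm_nonneg _) (fun j => ?_) h2
      have h3 : T j * x - x = (1 - star (e j)) * (e j * x - x) := by
        simp only [T]
        noncomm_ring
      rw [h3]
      refine (norm_mul_le _ _).trans ?_
      gcongr
      exact (norm_sub_le _ _).trans (add_le_add le_rfl (hse j))
    obtain ⟨D, hD, hg⟩ := hgrowth (M + ‖σ‖ * M + ‖σ‖ * M * M)
    exact I.mem_of_tendsto_mul_of_exp_growth hIc (fun a x hx => (hI a x hx).2) hγ0 hγ hD hTN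
      (fun j => hg (T j) (hTs j) (hTN j))
      (fun j ε hε => exists_dist_pow_le_of_map_mem_closure (ι : A →ₙₐ[ℂ] B) hk hp hq hpq hC hdiff I hI
        (hTJ j) hε) hTx
  rwa [hJI] at hfd

theorem eventually_cofinite_of_forall_injective {P : ℕ → Prop}
    (h : ∀ f : ℕ → ℕ, Function.Injective f → ∃ n, P (f n)) : ∀ᶠ n in cofinite, P n := by
  rw [eventually_cofinite]
  by_contra hinf
  obtain ⟨n, hn⟩ := h (fun n => Set.Infinite.natEmbedding _ hinf n)
    (Subtype.val_injective.comp (Function.Embedding.injective _))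
  exact (Set.Infinite.natEmbedding _ hinf n).2 hn

/-- The continuity ideal of a linear map on an algebra, as a linear subspace. -/
def continuitySubmodule {A X : Type*} [NormedRing A] [NormedAlgebra ℂ A]
    [NormedAddCommGroup X] [NormedSpace ℂ X] (θ : A →ₗ[ℂ] X) : Submodule ℂ A where
  carrier := {a | Continuous (fun b : A => θ (a * b)) ∧ Continuous (fun b : A => θ (b * a))}
  add_mem' := fun {a b} ha hb => by
    constructor
    · simpa only [add_mul, map_add] using ha.1.fun_add hb.1
    · simpa only [mul_add, map_add] using ha.2.fun_add hb.2
  zero_mem' := by simp [continuous_const]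
  smul_mem' := fun c a ha => by
    constructor
    · simpa only [smul_mul_assoc, map_smul] using ha.1.fun_const_smul c
    · simpa only [mul_smul_comm, map_smul] using ha.2.fun_const_smul c

theorem continuitySubmodule_mul_mem {A X : Type*} [NormedRing A] [NormedAlgebra ℂ A]
    [NormedAddCommGroup X] [NormedSpace ℂ X] (L : A →ₗ[ℂ] X →ₗ[ℂ] X) (R : X →ₗ[ℂ] A →ₗ[ℂ] X)
    (hXweak : ∀ a : A, Continuous (fun x : X => L a x) ∧ Continuous (fun x : X => R x a))
    (θ : A →ₗ[ℂ] X)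
    (hθ : ∀ a : A, Continuous (fun b : A => θ (a * b) - L a (θ b)) ∧
      Continuous (fun b : A => θ (b * a) - R (θ b) a))
    (c : A) {a : A} (ha : a ∈ continuitySubmodule θ) :
    c * a ∈ continuitySubmodule θ ∧ a * c ∈ continuitySubmodule θ := by
  refine ⟨⟨?_, ?_⟩, ⟨?_, ?_⟩⟩
  · have h1 := ((hθ c).1.comp (continuous_const_mul a)).fun_add ((hXweak c).1.comp ha.1)
    simpa only [Function.comp_def, sub_add_cancel, mul_assoc] using h1
  · simpa only [Function.comp_def, mul_assoc] using ha.2.comp (continuous_mul_const c)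
  · simpa only [Function.comp_def, mul_assoc] using ha.1.comp (continuous_const_mul c)
  · have h1 := ((hθ c).2.comp (continuous_mul_const a)).fun_add ((hXweak c).2.comp ha.2)
    simpa only [Function.comp_def, sub_add_cancel, mul_assoc] using h1

theorem eventually_sq_mem_continuitySubmodule {A X : Type*} [NormedRing A] [NormedAlgebra ℂ A] [CompleteSpace A]
    [NormedAddCommGroup X] [NormedSpace ℂ X] (L : A →ₗ[ℂ] X →ₗ[ℂ] X) (R : X →ₗ[ℂ] A →ₗ[ℂ] X)
    (hXweak : ∀ a : A, Continuous (fun x : X => L a x) ∧ Continuous (fun x : X => R x a))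
    (θ : A →ₗ[ℂ] X)
    (hθ : ∀ a : A, Continuous (fun b : A => θ (a * b) - L a (θ b)) ∧
      Continuous (fun b : A => θ (b * a) - R (θ b) a))
    {g : ℕ → A}
    (hg : ∀ m n, m ≠ n → g m * g n = 0) :
    ∀ᶠ n in cofinite, g n * g n ∈ continuitySubmodule θ := by
  refine Eventually.and ?_ ?_
  · refine eventually_cofinite_of_forall_injective fun f hf => ?_
    obtain ⟨n, hn⟩ := exists_continuous_comp_sq_of_orthogonal θ
      (fun n => ContinuousLinearMap.mul ℂ A (g (f n))) (fun n => ⟨L (g (f n)), (hXweak _).1⟩)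
      (fun n => (hθ (g (f n))).1) (fun m n hmn b => by
        simp [← mul_assoc, hg _ _ (hf.ne hmn)])
    exact ⟨n, by simpa [mul_assoc] using hn⟩
  · refine eventually_cofinite_of_forall_injective fun f hf => ?_
    obtain ⟨n, hn⟩ := exists_continuous_comp_sq_of_orthogonal θ
      (fun n => (ContinuousLinearMap.mul ℂ A).flip (g (f n)))
      (fun n => ⟨R.flip (g (f n)), (hXweak _).2⟩)
      (fun n => (hθ (g (f n))).2) (fun m n hmn b => by
        simp [mul_assoc, hg _ _ (hf.ne hmn.symm)])
    exact ⟨n, by simpa [mul_assoc] using hn⟩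

/-- A linear map is continuous if it is so after multiplication by each element of a closed left
ideal of finite codimension with a bounded left approximate identity. -/
theorem LinearMap.continuous_of_le_continuitySubmodule {A X J : Type*} [NormedRing A]
    [NormedAlgebra ℂ A] [CompleteSpace A] [NormedAddCommGroup X] [NormedSpace ℂ X]
    (θ : A →ₗ[ℂ] X) (I : Submodule ℂ A) (hIc : IsClosed (I : Set A))
    (hI : ∀ a x : A, x ∈ I → a * x ∈ I) (hIθ : I ≤ continuitySubmodule θ)
    [FiniteDimensional ℂ (A ⧸ I)] {F : Filter J} [F.NeBot] {e : J → A} (he : ∀ j, e j ∈ I) {M : ℝ}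
    (hM : ∀ j, ‖e j‖ ≤ M) (hlim : ∀ x ∈ I, Tendsto (fun j => e j * x) F (𝓝 x)) :
    Continuous θ := by
  obtain ⟨K, hK⟩ := exists_bound_factorization I hIc hI F e he M hM hlim
  have : CompleteSpace I := hIc.completeSpace_coe
  let τ : {a : A // a ∈ I ∧ ‖a‖ ≤ K} → I →L[ℂ] X := fun a =>
    ⟨θ ∘ₗ LinearMap.mulLeft ℂ (a : A) ∘ₗ I.subtype,
      (hIθ a.2.1).1.comp continuous_subtype_val⟩
  have hτ : ∀ a y, τ a y = θ (a * y) := fun _ _ => rfl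
  obtain ⟨c, hc⟩ := banach_steinhaus (g := τ) fun y => by
    let ρ : A →L[ℂ] X := ⟨θ ∘ₗ LinearMap.mulRight ℂ (y : A), (hIθ y.2).2⟩
    refine ⟨‖ρ‖ * K, fun a => ?_⟩
    exact (ρ.le_opNorm a).trans (by gcongr; exact a.2.2)
  refine θ.continuous_of_bound_on_finiteCodim I hIc (c * 3) fun b hb => ?_
  obtain ⟨a, ha, y, hy, rfl, haK, hyb⟩ := hK b hb
  have h1 := (τ ⟨a, ha, haK⟩).le_opNorm ⟨y, hy⟩
  have hc0 : 0 ≤ c := (norm_nonneg _).trans (hc ⟨a, ha, haK⟩)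
  calc ‖θ (a * y)‖ ≤ ‖τ ⟨a, ha, haK⟩‖ * ‖y‖ := h1
    _ ≤ c * (3 * ‖a * y‖) := by
      gcongr
      exact hc _
    _ = c * 3 * ‖a * y‖ := by ring

/-- Let `A` be a `(k,p,q)`-differential subalgebra in which every closed
two-sided `*`-ideal of finite codimension has a bounded left approximate identity.  If `X` is
a weak Banach `A`-bimodule and `θ : A → X` an `A`-intertwining operator, then `θ` is
continuous if and only if its continuity ideal
`𝓘(θ) = {a : A | b ↦ θ(a·b) and b ↦ θ(b·a) are continuous}` is closed in `A`. -/
theorem stmt15.{u}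
    {A : Type u} {B : Type*}
    [NormedRing A] [StarRing A] [NormedAlgebra ℂ A] [CompleteSpace A]
    [NonUnitalNormedRing B] [StarRing B] [CStarRing B] [NormedSpace ℂ B]
    [IsScalarTower ℂ B B] [SMulCommClass ℂ B B] [StarModule ℂ B] [CompleteSpace B]
    (hstar : Continuous (star : A → A))
    (ι : A →⋆ₙₐ[ℂ] B) (hinj : Function.Injective ι) (hcont : Continuous ι)
    (k : ℕ) (hk : 2 ≤ k) (p q : ℝ) (hp : 0 < p) (hq : 0 < q) (hpq : p + q = (k : ℝ))
    (C : ℝ) (hC : 0 < C)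
    (hdiff : ∀ a : A, ‖a ^ k‖ ≤ C * ‖a‖ ^ p * ‖ι a‖ ^ q)
    -- every closed two-sided `*`-ideal of finite codimension has a bounded
    -- left approximate identity:
    (hblai : ∀ I : Submodule ℂ A, IsClosed (I : Set A) →
      (∀ (a x : A), x ∈ I → a * x ∈ I ∧ x * a ∈ I) →
      (∀ x ∈ I, star x ∈ I) →
      FiniteDimensional ℂ (A ⧸ I) →
      ∃ (J : Type u) (F : Filter J) (e : J → A), F.NeBot ∧ (∀ j, e j ∈ I) ∧
        (∃ M : ℝ, ∀ j, ‖e j‖ ≤ M) ∧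
        ∀ x ∈ I, Filter.Tendsto (fun j => e j * x) F (nhds x))
    -- `X` a weak Banach `A`-bimodule:
    {X : Type*} [NormedAddCommGroup X] [NormedSpace ℂ X] [CompleteSpace X]
    (L : A →ₗ[ℂ] X →ₗ[ℂ] X) (R : X →ₗ[ℂ] A →ₗ[ℂ] X)
    (hL : ∀ (a b : A) (x : X), L (a * b) x = L a (L b x))
    (hR : ∀ (x : X) (a b : A), R x (a * b) = R (R x a) b)
    (hLR : ∀ (a : A) (x : X) (b : A), R (L a x) b = L a (R x b))
    (hXweak : ∀ a : A, Continuous (fun x : X => L a x) ∧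
      Continuous (fun x : X => R x a))
    -- `θ : A → X` an `A`-intertwining operator (with `A` a bimodule over itself):
    (θ : A →ₗ[ℂ] X)
    (hθ : ∀ a : A, Continuous (fun b : A => θ (a * b) - L a (θ b)) ∧
      Continuous (fun b : A => θ (b * a) - R (θ b) a)) :
    Continuous θ ↔
      IsClosed {a : A | Continuous (fun b : A => θ (a * b)) ∧
        Continuous (fun b : A => θ (b * a))} := by
  constructor
  · intro h
    convert isClosed_univ
    refine Set.eq_univ_of_forall fun a => ⟨?_, ?_⟩
    · exact h.comp (continuous_const_mul a)
    · exact h.comp (continuous_mul_const a)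
  intro hclosed
  have : ContinuousStar A := ⟨hstar⟩
  have : StarModule ℂ A := ⟨fun c a => hinj (by
    rw [map_star, map_smul, star_smul, map_smul, map_star])⟩
  let _ : NonUnitalCStarAlgebra B := {}
  let I : Submodule ℂ A :=
    { carrier := {a | a ∈ continuitySubmodule θ ∧ star a ∈ continuitySubmodule θ}
      add_mem' := fun {a b} ha hb => ⟨add_mem ha.1 hb.1, by
        rw [star_add]; exact add_mem ha.2 hb.2⟩
      zero_mem' := ⟨zero_mem _, by rw [star_zero]; exact zero_mem _⟩
      smul_mem' := fun c a ha => ⟨Submodule.smul_mem _ c ha.1, by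
        rw [star_smul]; exact Submodule.smul_mem _ _ ha.2⟩ }
  have hIc : IsClosed (I : Set A) := IsClosed.inter hclosed (hclosed.preimage hstar)
  have hI : ∀ a x : A, x ∈ I → a * x ∈ I ∧ x * a ∈ I := by
    intro a x hx
    have h1 := continuitySubmodule_mul_mem L R hXweak θ hθ a hx.1
    have h2 := continuitySubmodule_mul_mem L R hXweak θ hθ (star a) hx.2
    exact ⟨⟨h1.1, by rw [star_mul]; exact h2.2⟩, ⟨h1.2, by rw [star_mul]; exact h2.1⟩⟩
  have hIs : ∀ x ∈ I, star x ∈ I := fun x hx => ⟨hx.2, by rw [star_star]; exact hx.1⟩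
  have hfd : FiniteDimensional ℂ (A ⧸ I) := by
    refine finiteDimensional_quotient_of_orthogonal_sq_mem ι hcont hk hp hq hpq hC hdiff hblai
      I hIc hI hIs fun g hg => ?_
    have h1 := eventually_sq_mem_continuitySubmodule L R hXweak θ hθ hg
    have h2 := eventually_sq_mem_continuitySubmodule L R hXweak θ hθ (g := fun n => star (g n))
      fun m n hmn => by rw [← star_mul, hg n m hmn.symm, star_zero]
    obtain ⟨n, hn1, hn2⟩ := (h1.and h2).exists
    exact ⟨n, hn1, by rw [star_mul]; exact hn2⟩
  obtain ⟨ω, F, e, hF, he, ⟨M, hM⟩, hlim⟩ := hblai I hIc hI hIs hfd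
  exact θ.continuous_of_le_continuitySubmodule I hIc (fun a x hx => (hI a x hx).1)
    (fun x hx => hx.1) he hM hlim
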